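/- Let N ≥ 3 and let Ω be a smooth domain contained in the open half-space {x ∈ ℝ^N : x¹ > 0}, with 0 ∈ ∂Ω. Let c satisfy N − 1 < c ≤ N²/4 and let p ≥ p_{S_+^{N−1}} := 1 + 2/((N−2)/2 − √(N²/4 − c)). If u ∈ L^p_loc(Ω) is nonnegative, c|x|^{−2}u ∈ L¹_loc(Ω), and ∫ u(−Δφ − c|x|^{−2}φ) dx ≥ ∫ u^p φ dx for every nonnegative φ ∈ C_c^∞(Ω), then u ≡ 0 almost everywhere in Ω. -/

import Mathlib

open MeasureTheory Metric Filter
open scoped Topology ENNReal NNReal RealInnerProductSpace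

noncomputable section

/-- `ℝ^N` as a Euclidean space. -/
abbrev Euc (N : ℕ) : Type := EuclideanSpace ℝ (Fin N)

/-- `φ ∈ C_c^∞(Ω)`: smooth functions with compact support contained in `Ω`. -/
def IsTestFun {N : ℕ} (Ω : Set (Euc N)) (φ : Euc N → ℝ) : Prop :=
  ContDiff ℝ (⊤ : ℕ∞) φ ∧ HasCompactSupport φ ∧ tsupport φ ⊆ Ω

/-- The classical Laplacian of `φ` at `x`: the sum of the pure second partial derivatives. -/
def lap {N : ℕ} (φ : Euc N → ℝ) (x : Euc N) : ℝ :=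
  ∑ i : Fin N, iteratedFDeriv ℝ 2 φ x ![EuclideanSpace.single i 1, EuclideanSpace.single i 1]

/-- The best constant `μ(Ω)` in the Hardy inequality on `Ω` with the weight `|x|⁻²`. -/
def hardyConst {N : ℕ} (Ω : Set (Euc N)) : ℝ :=
  sInf {t : ℝ | ∃ φ : Euc N → ℝ, IsTestFun Ω φ ∧ φ ≠ 0 ∧
    t = (∫ x in Ω, ‖gradient φ x‖ ^ 2) / (∫ x in Ω, ‖x‖ ^ (-2 : ℝ) * φ x ^ 2)}

/-- A smooth domain of `ℝ^N`: a nonempty open connected set whose boundary is, near each of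
its points, the zero set of a smooth function with non-vanishing differential, the domain
being the corresponding sublevel set. -/
def IsSmoothDomain {N : ℕ} (Ω : Set (Euc N)) : Prop :=
  IsOpen Ω ∧ Ω.Nonempty ∧ IsConnected Ω ∧
    ∀ x ∈ frontier Ω, ∃ (U : Set (Euc N)) (f : Euc N → ℝ),
      IsOpen U ∧ x ∈ U ∧ ContDiff ℝ (⊤ : ℕ∞) f ∧ (∀ y ∈ U, fderiv ℝ f y ≠ 0) ∧
      Ω ∩ U = {y ∈ U | f y < 0} ∧ frontier Ω ∩ U = {y ∈ U | f y = 0}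

/-! ### Jets -/

lemma lap_eq' {N : ℕ} {φ : Euc N → ℝ} {x : Euc N} (h : ContDiffAt ℝ 2 φ x) :
    lap φ x = ∑ i : Fin N, fderiv ℝ (fun y => fderiv ℝ φ y (EuclideanSpace.single i 1)) x
      (EuclideanSpace.single i 1) := by
  unfold lap
  refine Finset.sum_congr rfl fun i _ => ?_
  rw [iteratedFDeriv_two_apply]
  have hd : DifferentiableAt ℝ (fderiv ℝ φ) x :=
    (h.fderiv_right (m := 1) (by norm_num)).differentiableAt (by norm_num)
  rw [fderiv_clm_apply hd (differentiableAt_const _)]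
  simp

lemma pd_diff {N : ℕ} {φ : Euc N → ℝ} {x : Euc N} (h : ContDiffAt ℝ 2 φ x) (e : Euc N) :
    DifferentiableAt ℝ (fun y => fderiv ℝ φ y e) x := by
  have hd : DifferentiableAt ℝ (fderiv ℝ φ) x :=
    (h.fderiv_right (m := 1) (by norm_num)).differentiableAt (by norm_num)
  exact hd.clm_apply (differentiableAt_const _)

lemma ev_diff {N : ℕ} {φ : Euc N → ℝ} {x : Euc N} (h : ContDiffAt ℝ 2 φ x) :
    ∀ᶠ y in 𝓝 x, DifferentiableAt ℝ φ y :=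
  (h.eventually (by simp)).mono fun _ hy => hy.differentiableAt (by norm_num)

/-- `φ` is `C²` at `x`, gradient `α e_{i0} + β x`, Laplacian `L`. -/
structure Jet {N : ℕ} (i0 : Fin N) (φ : Euc N → ℝ) (x : Euc N) (α β L : ℝ) : Prop where
  cd : ContDiffAt ℝ 2 φ x
  gr : ∀ i, fderiv ℝ φ x (EuclideanSpace.single i 1) = α * (if i = i0 then 1 else 0) + β * x i
  lp : lap φ x = L

lemma sum_gr {N : ℕ} (i0 : Fin N) (x : Euc N) (α β α' β' : ℝ) :
    ∑ i : Fin N, (α * (if i = i0 then 1 else 0) + β * x i) *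
      (α' * (if i = i0 then 1 else 0) + β' * x i) =
    α * α' + (α * β' + α' * β) * x i0 + β * β' * ‖x‖ ^ 2 := by
  have h1 : ∀ i : Fin N, (α * (if i = i0 then 1 else 0) + β * x i) *
      (α' * (if i = i0 then 1 else 0) + β' * x i) =
      (if i = i0 then (α * α' + (α * β' + α' * β) * x i) else 0) + β * β' * (x i) ^ 2 := by
    intro i
    split_ifs <;> ring
  rw [Finset.sum_congr rfl fun i _ => h1 i, Finset.sum_add_distrib, ← Finset.mul_sum,
    EuclideanSpace.real_norm_sq_eq]
  simp

lemma Jet.mul {N : ℕ} {i0 : Fin N} {f g : Euc N → ℝ} {x : Euc N} {α β L α' β' L' : ℝ}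
    (hf : Jet i0 f x α β L) (hg : Jet i0 g x α' β' L') :
    Jet i0 (fun y => f y * g y) x (f x * α' + g x * α) (f x * β' + g x * β)
      (f x * L' + g x * L + 2 * (α * α' + (α * β' + α' * β) * x i0 + β * β' * ‖x‖ ^ 2)) := by
  have hfd := hf.cd.differentiableAt (by norm_num)
  have hgd := hg.cd.differentiableAt (by norm_num)
  refine ⟨hf.cd.mul hg.cd, fun i => ?_, ?_⟩
  · rw [fderiv_fun_mul hfd hgd]
    simp only [add_apply, smul_apply, smul_eq_mul,
      hf.gr, hg.gr]
    ring
  · rw [lap_eq' (hf.cd.mul hg.cd), ← hf.lp, ← hg.lp, lap_eq' hf.cd, lap_eq' hg.cd,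
      ← sum_gr, Finset.mul_sum, Finset.mul_sum, Finset.mul_sum, ← Finset.sum_add_distrib,
      ← Finset.sum_add_distrib]
    refine Finset.sum_congr rfl fun i _ => ?_
    have he : (fun y => fderiv ℝ (fun y => f y * g y) y (EuclideanSpace.single i 1)) =ᶠ[𝓝 x]
        fun y => f y * fderiv ℝ g y (EuclideanSpace.single i 1)
          + g y * fderiv ℝ f y (EuclideanSpace.single i 1) := by
      filter_upwards [ev_diff hf.cd, ev_diff hg.cd] with y h1 h2
      rw [fderiv_fun_mul h1 h2]
      simp
    rw [he.fderiv_eq, fderiv_fun_add (hfd.fun_mul (pd_diff hg.cd _)) (hgd.fun_mul (pd_diff hf.cd _)),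
      fderiv_fun_mul hfd (pd_diff hg.cd _), fderiv_fun_mul hgd (pd_diff hf.cd _)]
    simp only [add_apply, smul_apply, smul_eq_mul,
      hf.gr, hg.gr]
    ring

lemma Jet.add {N : ℕ} {i0 : Fin N} {f g : Euc N → ℝ} {x : Euc N} {α β L α' β' L' : ℝ}
    (hf : Jet i0 f x α β L) (hg : Jet i0 g x α' β' L') :
    Jet i0 (fun y => f y + g y) x (α + α') (β + β') (L + L') := by
  have hfd := hf.cd.differentiableAt (by norm_num)
  have hgd := hg.cd.differentiableAt (by norm_num)
  refine ⟨hf.cd.add hg.cd, fun i => ?_, ?_⟩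
  · rw [fderiv_fun_add hfd hgd]
    simp only [add_apply, hf.gr, hg.gr]
    ring
  · rw [lap_eq' (hf.cd.add hg.cd), ← hf.lp, ← hg.lp, lap_eq' hf.cd, lap_eq' hg.cd,
      ← Finset.sum_add_distrib]
    refine Finset.sum_congr rfl fun i _ => ?_
    have he : (fun y => fderiv ℝ (fun y => f y + g y) y (EuclideanSpace.single i 1)) =ᶠ[𝓝 x]
        fun y => fderiv ℝ f y (EuclideanSpace.single i 1)
          + fderiv ℝ g y (EuclideanSpace.single i 1) := by
      filter_upwards [ev_diff hf.cd, ev_diff hg.cd] with y h1 h2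
      rw [fderiv_fun_add h1 h2]
      simp
    rw [he.fderiv_eq, fderiv_fun_add (pd_diff hf.cd _) (pd_diff hg.cd _)]
    simp

lemma Jet.comp {N : ℕ} {i0 : Fin N} {f : Euc N → ℝ} {x : Euc N} {α β L : ℝ}
    (hf : Jet i0 f x α β L) {F Fd : ℝ → ℝ} {Fdd : ℝ} (hF : ContDiffAt ℝ 2 F (f x))
    (hFd : ∀ᶠ y in 𝓝 (f x), HasDerivAt F (Fd y) y) (hFdd : HasDerivAt Fd Fdd (f x)) :
    Jet i0 (fun y => F (f y)) x (Fd (f x) * α) (Fd (f x) * β)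
      (Fdd * (α * α + (α * β + α * β) * x i0 + β * β * ‖x‖ ^ 2) + Fd (f x) * L) := by
  have hfd := hf.cd.differentiableAt (by norm_num)
  have hcd : ContDiffAt ℝ 2 (fun y => F (f y)) x := hF.comp x hf.cd
  refine ⟨hcd, fun i => ?_, ?_⟩
  · have := (hFd.self_of_nhds.comp_hasFDerivAt x hfd.hasFDerivAt).fderiv
    simp only [Function.comp_def] at this
    rw [this]
    simp only [smul_apply, smul_eq_mul, hf.gr]
    ring
  · rw [lap_eq' hcd, ← hf.lp, lap_eq' hf.cd,
      ← sum_gr, Finset.mul_sum, Finset.mul_sum, ← Finset.sum_add_distrib]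
    refine Finset.sum_congr rfl fun i _ => ?_
    have he : (fun y => fderiv ℝ (fun y => F (f y)) y (EuclideanSpace.single i 1)) =ᶠ[𝓝 x]
        fun y => Fd (f y) * fderiv ℝ f y (EuclideanSpace.single i 1) := by
      filter_upwards [ev_diff hf.cd, hfd.continuousAt.eventually hFd] with y h1 h2
      have := (h2.comp_hasFDerivAt y h1.hasFDerivAt).fderiv
      simp only [Function.comp_def] at this
      rw [this]
      simp
    have h3 := hFdd.comp_hasFDerivAt x hfd.hasFDerivAt
    have h4 := (h3.fun_mul (pd_diff hf.cd (EuclideanSpace.single i 1)).hasFDerivAt).fderiv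
    simp only [Function.comp_def] at h4
    rw [he.fderiv_eq, h4]
    simp only [add_apply, smul_apply, smul_eq_mul,
      hf.gr]
    ring

lemma Jet.const {N : ℕ} (i0 : Fin N) (x : Euc N) (r : ℝ) : Jet i0 (fun _ => r) x 0 0 0 := by
  refine ⟨contDiffAt_const, fun i => by simp, ?_⟩
  rw [lap_eq' contDiffAt_const]; simp

lemma Jet.coord {N : ℕ} (i0 : Fin N) (x : Euc N) : Jet i0 (fun y => y i0) x 1 0 0 := by
  have hcd : ContDiff ℝ 2 (fun y : Euc N => y i0) := (EuclideanSpace.proj (𝕜 := ℝ) i0).contDiff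
  have hf : ∀ y : Euc N, fderiv ℝ (fun y : Euc N => y i0) y = EuclideanSpace.proj (𝕜 := ℝ) i0 :=
    fun y => (EuclideanSpace.proj (𝕜 := ℝ) i0).fderiv
  refine ⟨hcd.contDiffAt, fun i => ?_, ?_⟩
  · rw [hf]; simp [eq_comm]
  · rw [lap_eq' hcd.contDiffAt]; simp [hf]

lemma Jet.normsq {N : ℕ} (i0 : Fin N) (x : Euc N) : Jet i0 (fun y => ‖y‖ ^ 2) x 0 2 (2 * N) := by
  have hcd : ContDiff ℝ 2 (fun y : Euc N => ‖y‖ ^ 2) := contDiff_norm_sq ℝ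
  have hf : ∀ y e : Euc N, fderiv ℝ (fun y : Euc N => ‖y‖ ^ 2) y e = 2 * inner ℝ y e := by
    intro y e
    rw [fderiv_norm_sq_apply]; simp
  have hi : ∀ (y : Euc N) i, inner ℝ y (EuclideanSpace.single i (1:ℝ)) = y i := by
    intro y i; rw [EuclideanSpace.inner_single_right]; simp
  refine ⟨hcd.contDiffAt, fun i => ?_, ?_⟩
  · rw [hf, hi]; ring
  · rw [lap_eq' hcd.contDiffAt]
    have : ∀ i : Fin N, fderiv ℝ (fun y => fderiv ℝ (fun y : Euc N => ‖y‖ ^ 2) y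
        (EuclideanSpace.single i 1)) x (EuclideanSpace.single i 1) = 2 := by
      intro i
      have : (fun y => fderiv ℝ (fun y : Euc N => ‖y‖ ^ 2) y (EuclideanSpace.single i 1)) =
        fun y => (2:ℝ) * EuclideanSpace.proj (𝕜 := ℝ) i y := by
        funext y; rw [hf, hi]; simp
      rw [this, fderiv_const_mul (by fun_prop), ContinuousLinearMap.fderiv]
      simp
    rw [Finset.sum_congr rfl fun i _ => this i]
    simp [mul_comm]

lemma Jet.congr {N : ℕ} {i0 : Fin N} {f g : Euc N → ℝ} {x : Euc N} {α β L α' β' L' : ℝ}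
    (hf : Jet i0 f x α β L) (hfg : ∀ y, g y = f y) (h1 : α' = α) (h2 : β' = β) (h3 : L' = L) :
    Jet i0 g x α' β' L' := by
  have : g = f := funext hfg
  subst this h1 h2 h3; exact hf

lemma quad_nonneg {N : ℕ} (i0 : Fin N) (x : Euc N) (α β : ℝ) :
    0 ≤ α * α + (α * β + α * β) * x i0 + β * β * ‖x‖ ^ 2 := by
  rw [← sum_gr]
  exact Finset.sum_nonneg fun i _ => mul_self_nonneg _

/-! ### The convex cut-off -/

def hh (δ s : ℝ) : ℝ := s * expNegInvGlue (s / δ)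

lemma hh_contDiff (δ : ℝ) {n : WithTop ℕ∞} (hn : n ≤ ((⊤ : ℕ∞) : WithTop ℕ∞)) :
    ContDiff ℝ n (hh δ) := by
  have h1 : ContDiff ℝ n expNegInvGlue :=
    (expNegInvGlue.contDiff (n := (⊤ : ℕ∞))).of_le hn
  exact contDiff_id.mul (h1.comp (contDiff_id.div_const δ))

lemma deriv_zero_left {f : ℝ → ℝ} (hf : Differentiable ℝ f) (h0 : ∀ s ≤ 0, f s = 0) :
    ∀ s ≤ 0, deriv f s = 0 := by
  intro s hs
  have h1 : HasDerivWithinAt f (deriv f s) (Set.Iic s) s := (hf s).hasDerivAt.hasDerivWithinAt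
  have h2 : HasDerivWithinAt f 0 (Set.Iic s) s :=
    (hasDerivWithinAt_const s (Set.Iic s) (0:ℝ)).congr (fun y hy => h0 y (le_trans hy hs)) (h0 s hs)
  exact (uniqueDiffWithinAt_Iic s).eq_deriv _ h1 h2

lemma hh_nonpos {δ : ℝ} (hδ : 0 < δ) {s : ℝ} (hs : s ≤ 0) : hh δ s = 0 := by
  unfold hh
  rw [expNegInvGlue.zero_of_nonpos (div_nonpos_of_nonpos_of_nonneg hs hδ.le)]; simp

lemma hh_pos {δ : ℝ} (hδ : 0 < δ) {s : ℝ} (hs : 0 < s) : hh δ s = s * Real.exp (-(δ / s)) := by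
  unfold hh expNegInvGlue
  rw [if_neg (not_le.2 (div_pos hs hδ)), inv_div]

lemma hh_nonneg {δ : ℝ} (hδ : 0 < δ) (s : ℝ) : 0 ≤ hh δ s := by
  rcases le_or_gt s 0 with h | h
  · rw [hh_nonpos hδ h]
  · rw [hh_pos hδ h]; positivity

lemma hh_ge {δ : ℝ} (hδ : 0 < δ) {s : ℝ} (hs : 0 < s) : s - δ ≤ hh δ s := by
  rw [hh_pos hδ hs]
  have := Real.add_one_le_exp (-(δ / s))
  calc s - δ = s * (-(δ/s) + 1) := by field_simp; ring
    _ ≤ _ := by gcongr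

lemma hh_le {δ : ℝ} (hδ : 0 < δ) {s : ℝ} (hs : 0 ≤ s) : hh δ s ≤ s := by
  rcases hs.eq_or_lt with h | h
  · rw [← h, hh_nonpos hδ le_rfl]
  · rw [hh_pos hδ h]
    have : Real.exp (-(δ / s)) ≤ 1 := Real.exp_le_one_iff.2 (by
      have : 0 < δ / s := by positivity
      linarith)
    nlinarith

lemma hh_hasDeriv {δ : ℝ} (hδ : 0 < δ) {s : ℝ} (hs : 0 < s) :
    HasDerivAt (hh δ) (Real.exp (-(δ / s)) * (1 + δ / s)) s := by
  have h1 : HasDerivAt (fun s : ℝ => s * Real.exp (-(δ / s)))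
      (1 * Real.exp (-(δ / s)) + s * (Real.exp (-(δ / s)) * (-(-δ / s ^ 2)))) s := by
    have h2 : HasDerivAt (fun s : ℝ => δ / s) (-δ / s ^ 2) s := by
      have := (hasDerivAt_const s δ).fun_div (hasDerivAt_id' s) hs.ne'
      simpa using this
    exact (hasDerivAt_id s).mul (h2.neg.exp)
  have h3 : hh δ =ᶠ[𝓝 s] (fun s : ℝ => s * Real.exp (-(δ / s))) := by
    filter_upwards [lt_mem_nhds hs] with y hy using hh_pos hδ hy
  refine (h1.congr_of_eventuallyEq h3).congr_deriv ?_
  field_simp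

lemma hh_deriv_pos {δ : ℝ} (hδ : 0 < δ) {s : ℝ} (hs : 0 < s) :
    deriv (hh δ) s = Real.exp (-(δ / s)) * (1 + δ / s) := (hh_hasDeriv hδ hs).deriv

lemma hh_diff (δ : ℝ) : Differentiable ℝ (hh δ) :=
  (hh_contDiff δ (n := 1) (by norm_cast)).differentiable (by norm_num)

lemma hh_deriv_nonpos {δ : ℝ} (hδ : 0 < δ) {s : ℝ} (hs : s ≤ 0) : deriv (hh δ) s = 0 :=
  deriv_zero_left (hh_diff δ) (fun _ h => hh_nonpos hδ h) s hs

lemma hh_deriv_nonneg {δ : ℝ} (hδ : 0 < δ) (s : ℝ) : 0 ≤ deriv (hh δ) s := by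
  rcases le_or_gt s 0 with h | h
  · rw [hh_deriv_nonpos hδ h]
  · rw [hh_deriv_pos hδ h]; positivity

lemma hh_deriv_le_one {δ : ℝ} (hδ : 0 < δ) (s : ℝ) : deriv (hh δ) s ≤ 1 := by
  rcases le_or_gt s 0 with h | h
  · rw [hh_deriv_nonpos hδ h]; norm_num
  · rw [hh_deriv_pos hδ h]
    have := Real.add_one_le_exp (δ / s)
    rw [Real.exp_neg, inv_mul_le_iff₀ (Real.exp_pos _)]
    linarith

lemma hh_deriv_diff (δ : ℝ) : Differentiable ℝ (deriv (hh δ)) := by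
  have h : ContDiff ℝ 2 (hh δ) := hh_contDiff δ (by norm_cast)
  have h2 : ContDiff ℝ (1 + 1) (hh δ) := by norm_num; exact h
  exact (contDiff_succ_iff_deriv.1 h2).2.2.differentiable (by norm_num)

lemma hh_deriv2_nonneg {δ : ℝ} (hδ : 0 < δ) (s : ℝ) : 0 ≤ deriv (deriv (hh δ)) s := by
  rcases le_or_gt s 0 with h | h
  · rw [deriv_zero_left (hh_deriv_diff δ) (fun _ h => hh_deriv_nonpos hδ h) s h]
  · have h3 : deriv (hh δ) =ᶠ[𝓝 s] (fun s : ℝ => Real.exp (-(δ / s)) * (1 + δ / s)) := by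
      filter_upwards [lt_mem_nhds h] with y hy using hh_deriv_pos hδ hy
    have h2 : HasDerivAt (fun s : ℝ => δ / s) (-δ / s ^ 2) s := by
      have := (hasDerivAt_const s δ).fun_div (hasDerivAt_id' s) h.ne'
      simpa using this
    have h4 := h2.neg.exp.mul (h2.const_add 1)
    rw [h3.deriv_eq]
    have h5 : deriv (fun s : ℝ => Real.exp (-(δ / s)) * (1 + δ / s)) s = _ := h4.deriv
    rw [h5]
    have : Real.exp (-(δ / s)) * -(-δ / s ^ 2) * (1 + δ / s) + Real.exp (-(δ / s)) * (-δ / s ^ 2)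
      = Real.exp (-(δ / s)) * (δ ^ 2 / s ^ 3) := by field_simp; ring
    simp only [Pi.neg_apply]
    rw [this]; positivity

lemma hh_euler_le {δ : ℝ} (hδ : 0 < δ) {s : ℝ} (hs : 0 < s) :
    deriv (hh δ) s * s - hh δ s ≤ δ := by
  rw [hh_deriv_pos hδ hs, hh_pos hδ hs]
  have : Real.exp (-(δ / s)) ≤ 1 := Real.exp_le_one_iff.2 (by
      have : 0 < δ / s := by positivity
      linarith)
  have h2 : Real.exp (-(δ / s)) * (1 + δ / s) * s - s * Real.exp (-(δ / s)) =
    δ * Real.exp (-(δ / s)) := by field_simp; ring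
  rw [h2]; nlinarith

lemma hh_euler_ge {δ : ℝ} (hδ : 0 < δ) {s : ℝ} (hs : 0 < s) :
    hh δ s ≤ deriv (hh δ) s * s := by
  rw [hh_deriv_pos hδ hs, hh_pos hδ hs]
  have h2 : Real.exp (-(δ / s)) * (1 + δ / s) * s - s * Real.exp (-(δ / s)) =
    δ * Real.exp (-(δ / s)) := by field_simp; ring
  have : 0 < δ * Real.exp (-(δ / s)) := by positivity
  linarith

/-! ### The basic functions -/

def PP {N : ℕ} (i0 : Fin N) (K : ℝ) (y : Euc N) : ℝ :=
  (‖y‖ ^ 2) ^ (-(N : ℝ) / 2) * (y i0 - K * ‖y‖ ^ 2)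

def SS {N : ℕ} (i0 : Fin N) (K : ℝ) (y : Euc N) : ℝ :=
  (‖y‖ ^ 2)⁻¹ * (1 - 2 * K * y i0 + K ^ 2 * ‖y‖ ^ 2)

def TT {N : ℕ} (i0 : Fin N) (K : ℝ) (y : Euc N) : ℝ := Real.log (SS i0 K y) / 2

lemma jet_lin {N : ℕ} (i0 : Fin N) (x : Euc N) (a b d : ℝ) :
    Jet i0 (fun y => a + b * y i0 + d * ‖y‖ ^ 2) x b (2 * d) (2 * N * d) := by
  have h := ((Jet.const i0 x a).add ((Jet.const i0 x b).mul (Jet.coord i0 x))).add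
    ((Jet.const i0 x d).mul (Jet.normsq i0 x))
  refine h.congr (fun y => rfl) ?_ ?_ ?_ <;> ring

lemma jet_rpow {N : ℕ} (i0 : Fin N) {x : Euc N} (hx : x ≠ 0) (γ : ℝ) :
    Jet i0 (fun y => (‖y‖ ^ 2) ^ γ) x 0 (2 * γ * (‖x‖ ^ 2) ^ γ / ‖x‖ ^ 2)
      ((‖x‖ ^ 2) ^ γ / ‖x‖ ^ 2 * (4 * γ * (γ - 1) + 2 * N * γ)) := by
  have hR : 0 < ‖x‖ ^ 2 := by have := norm_pos_iff.2 hx; positivity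
  have h := (Jet.normsq i0 x).comp (F := fun r => r ^ γ) (Fd := fun r => γ * r ^ (γ - 1))
    (Fdd := γ * ((γ - 1) * (‖x‖ ^ 2) ^ (γ - 1 - 1)))
    (Real.contDiffAt_rpow_const_of_ne hR.ne')
    ((lt_mem_nhds hR).mono fun y hy => Real.hasDerivAt_rpow_const (Or.inl hy.ne'))
    ((Real.hasDerivAt_rpow_const (Or.inl hR.ne')).const_mul γ)
  refine h.congr (fun y => rfl) ?_ ?_ ?_
  · simp
  · simp only [Real.rpow_sub_one hR.ne']; ring
  · simp only [Real.rpow_sub_one hR.ne']; field_simp; ring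

lemma jet_P {N : ℕ} (i0 : Fin N) (K : ℝ) {x : Euc N} (hx : x ≠ 0) :
    Jet i0 (PP i0 K) x ((‖x‖ ^ 2) ^ (-(N : ℝ) / 2))
      ((‖x‖ ^ 2) ^ (-(N : ℝ) / 2) * (-2 * K - N * (x i0 - K * ‖x‖ ^ 2) / ‖x‖ ^ 2)) 0 := by
  have hR : 0 < ‖x‖ ^ 2 := by have := norm_pos_iff.2 hx; positivity
  have h := (jet_rpow i0 hx (-(N : ℝ) / 2)).mul (jet_lin i0 x 0 1 (-K))
  refine h.congr (fun y => ?_) ?_ ?_ ?_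
  · unfold PP; ring
  · ring
  · field_simp; ring
  · field_simp; ring

lemma jet_S {N : ℕ} (i0 : Fin N) (K : ℝ) {x : Euc N} (hx : x ≠ 0) :
    Jet i0 (SS i0 K) x (-2 * K / ‖x‖ ^ 2) (-2 * (1 - 2 * K * x i0) / (‖x‖ ^ 2) ^ 2)
      (((8 - 2 * N) * (1 - 2 * K * x i0) + 8 * K * x i0) / (‖x‖ ^ 2) ^ 2) := by
  have hR : 0 < ‖x‖ ^ 2 := by have := norm_pos_iff.2 hx; positivity
  have h := (jet_rpow i0 hx (-1)).mul (jet_lin i0 x 1 (-2 * K) (K ^ 2))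
  refine h.congr (fun y => ?_) ?_ ?_ ?_
  · unfold SS; rw [Real.rpow_neg_one]; ring
  · rw [Real.rpow_neg_one]; field_simp; ring
  · rw [Real.rpow_neg_one]; field_simp; ring
  · rw [Real.rpow_neg_one]; field_simp; ring

lemma jet_T {N : ℕ} (i0 : Fin N) (K : ℝ) {x : Euc N} (hx : x ≠ 0) (hs : 0 < SS i0 K x) :
    ∃ α β L, Jet i0 (TT i0 K) x α β L ∧
      α * α + (α * β + α * β) * x i0 + β * β * ‖x‖ ^ 2 = ((‖x‖ ^ 2) ^ 2 * SS i0 K x)⁻¹ ∧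
      PP i0 K x * L + 2 * ((‖x‖ ^ 2) ^ (-(N : ℝ) / 2) * α +
        ((‖x‖ ^ 2) ^ (-(N : ℝ) / 2) * β + α * ((‖x‖ ^ 2) ^ (-(N : ℝ) / 2) * (-2 * K - N * (x i0 - K * ‖x‖ ^ 2) / ‖x‖ ^ 2))) * x i0
        + ((‖x‖ ^ 2) ^ (-(N : ℝ) / 2) * (-2 * K - N * (x i0 - K * ‖x‖ ^ 2) / ‖x‖ ^ 2)) * β * ‖x‖ ^ 2)
        = N * ((‖x‖ ^ 2) ^ 2 * SS i0 K x)⁻¹ * PP i0 K x := by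
  have hR : 0 < ‖x‖ ^ 2 := by have := norm_pos_iff.2 hx; positivity
  have hd : ∀ y : ℝ, 0 < y → HasDerivAt (fun r => Real.log r / 2) (y⁻¹ / 2) y :=
    fun y hy => (Real.hasDerivAt_log hy.ne').div_const 2
  have h := (jet_S i0 K hx).comp (F := fun r => Real.log r / 2) (Fd := fun r => r⁻¹ / 2)
    (Fdd := (-(SS i0 K x ^ 2)⁻¹) / 2)
    ((Real.contDiffAt_log.2 hs.ne').div_const 2)
    ((lt_mem_nhds hs).mono fun y hy => hd y hy)
    ((hasDerivAt_inv hs.ne').div_const 2)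
  refine ⟨_, _, _, h, ?_, ?_⟩
  · have hs' := hs
    unfold SS at hs' ⊢
    have h1 : 0 < 1 - 2 * K * x i0 + K ^ 2 * ‖x‖ ^ 2 := by
      rcases pos_and_pos_or_neg_and_neg_of_mul_pos hs' with h | h
      · exact h.2
      · have := inv_pos.2 hR; linarith [h.1]
    have hne := h1.ne'
    generalize ‖x‖ ^ 2 = R at *
    generalize x i0 = a at *
    obtain ⟨D, hD⟩ : ∃ D, D = 1 - 2 * K * a + K ^ 2 * R := ⟨_, rfl⟩
    rw [← hD] at hne ⊢
    field_simp
    rw [hD]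
    ring
  · have hs' := hs
    unfold SS at hs'
    have h1 : 0 < 1 - 2 * K * x i0 + K ^ 2 * ‖x‖ ^ 2 := by
      rcases pos_and_pos_or_neg_and_neg_of_mul_pos hs' with h | h
      · exact h.2
      · have := inv_pos.2 hR; linarith [h.1]
    unfold SS PP
    have hne := h1.ne'
    generalize (‖x‖ ^ 2) ^ (-(N : ℝ) / 2) = B
    generalize ‖x‖ ^ 2 = R at *
    generalize x i0 = a at *
    obtain ⟨D, hD⟩ : ∃ D, D = 1 - 2 * K * a + K ^ 2 * R := ⟨_, rfl⟩
    rw [← hD] at hne ⊢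
    field_simp
    rw [hD]
    ring

lemma jet_W {N : ℕ} (i0 : Fin N) (K : ℝ) {x : Euc N} (hx : x ≠ 0) (hs : 0 < SS i0 K x)
    {Q : ℝ → ℝ} (hQ : ContDiff ℝ 2 Q) :
    ∃ α β, Jet i0 (fun y => PP i0 K y * Q (TT i0 K y)) x α β
      (((‖x‖ ^ 2) ^ 2 * SS i0 K x)⁻¹ * PP i0 K x *
        (deriv (deriv Q) (TT i0 K x) + N * deriv Q (TT i0 K x))) := by
  obtain ⟨α, β, L, hT, h1, h2⟩ := jet_T i0 K hx hs
  have hQ2 : ContDiff ℝ (1 + 1) Q := by norm_num; exact hQ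
  have hQ' := (contDiff_succ_iff_deriv.1 hQ2).2.2
  have h := (jet_P i0 K hx).mul (hT.comp (F := Q) (Fd := deriv Q)
    (Fdd := deriv (deriv Q) (TT i0 K x)) hQ.contDiffAt
    (Eventually.of_forall fun y => (hQ.differentiable (by norm_num) y).hasDerivAt)
    ((hQ'.differentiable (by norm_num)) _).hasDerivAt)
  refine ⟨_, _, h.congr (fun y => rfl) rfl rfl ?_⟩
  rw [h1]
  linear_combination (-deriv Q (TT i0 K x)) * h2
/-! ### One-dimensional profiles -/

lemma contDiff_deriv2 {f : ℝ → ℝ} (hf : ContDiff ℝ (⊤ : ℕ∞) f) :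
    ContDiff ℝ (⊤ : ℕ∞) (deriv f) := by
  have h2 : ContDiff ℝ (((⊤ : ℕ∞) : WithTop ℕ∞) + 1) f := by exact hf
  exact (contDiff_succ_iff_deriv.1 h2).2.2

lemma smooth_diff {f : ℝ → ℝ} (hf : ContDiff ℝ (⊤ : ℕ∞) f) : Differentiable ℝ f :=
  hf.differentiable (by simp)

lemma hh_smooth (δ : ℝ) : ContDiff ℝ (⊤ : ℕ∞) (hh δ) := hh_contDiff δ le_rfl

/-- properties of the composed profile -/
lemma profile_comp {k0 : ℝ → ℝ} (hk0 : ContDiff ℝ (⊤ : ℕ∞) k0) {ν C t : ℝ}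
    (hpos : 0 < k0 t) (hd : 0 ≤ deriv k0 t)
    (hode : C * Real.exp (-t) * k0 t ≤ deriv (deriv k0) t + 2 * ν * deriv k0 t) (hC : 0 ≤ C) :
    C * Real.exp (-t) * hh 1 (k0 t) ≤ deriv (deriv fun s => hh 1 (k0 s)) t
      + 2 * ν * deriv (fun s => hh 1 (k0 s)) t := by
  have hd1 : ∀ s, deriv (fun s => hh 1 (k0 s)) s = deriv (hh 1) (k0 s) * deriv k0 s := fun s =>
    ((hh_diff 1 (k0 s)).hasDerivAt.comp s (smooth_diff hk0 s).hasDerivAt).deriv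
  have hd2 : deriv (deriv fun s => hh 1 (k0 s)) t =
      (deriv (deriv (hh 1)) (k0 t) * deriv k0 t) * deriv k0 t
        + deriv (hh 1) (k0 t) * deriv (deriv k0) t := by
    rw [funext hd1]
    exact (((hh_deriv_diff 1 (k0 t)).hasDerivAt.comp t (smooth_diff hk0 t).hasDerivAt).fun_mul
      (smooth_diff (contDiff_deriv2 hk0) t).hasDerivAt).deriv
  rw [hd2, hd1]
  have h1 := hh_deriv2_nonneg one_pos (k0 t)
  have h2 := hh_deriv_nonneg one_pos (k0 t)
  have h3 := hh_euler_ge one_pos hpos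
  have h4 : C * Real.exp (-t) * hh 1 (k0 t) ≤ C * Real.exp (-t) * (deriv (hh 1) (k0 t) * k0 t) := by
    gcongr
  have h5 := mul_le_mul_of_nonneg_left hode h2
  have h6 : 0 ≤ deriv (deriv (hh 1)) (k0 t) * deriv k0 t * deriv k0 t := by positivity
  nlinarith

def IsProfile (ν C t0 : ℝ) (θ : ℕ) (M T0 : ℝ) (k : ℝ → ℝ) : Prop :=
  ContDiff ℝ (⊤ : ℕ∞) k ∧ (∀ t ≤ t0, k t = 0) ∧ (∀ t, t0 < t → 0 < k t) ∧
  (∀ t, t0 < t → C * Real.exp (-t) * k t ≤ deriv (deriv k) t + 2 * ν * deriv k t) ∧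
  (∀ t, T0 ≤ t → 0 ≤ deriv k t ∧ k t ≤ M * t ^ θ ∧ deriv k t * t ^ θ ≤ M * k t ∧ ν * t ^ θ ≤ M)

lemma exists_profile {ν C : ℝ} (hν : 0 ≤ ν) (hC : 0 ≤ C) (tmin : ℝ) :
    ∃ (t0 : ℝ) (θ : ℕ) (M T0 : ℝ) (k : ℝ → ℝ), tmin ≤ t0 ∧ θ ≤ 1 ∧ 0 < M ∧ 1 ≤ T0 ∧ t0 < T0 ∧
      IsProfile ν C t0 θ M T0 k := by
  rcases hν.eq_or_lt with h0 | hpos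
  · -- ν = 0
    subst h0
    obtain ⟨t0, ht1, ht2⟩ : ∃ t0, tmin ≤ t0 ∧ 16 * C ≤ Real.exp t0 := by
      have h := Real.tendsto_exp_atTop.eventually_ge_atTop (16 * C)
      obtain ⟨t0, h1, h2⟩ := (h.and (eventually_ge_atTop tmin)).exists
      exact ⟨t0, h2, h1⟩
    set k0 : ℝ → ℝ := fun t => 2 * Real.log (1 + Real.exp ((t - t0) / 2)) - 2 * Real.log 2 with hk0
    have hE : ∀ t, HasDerivAt (fun t => Real.exp ((t - t0) / 2)) (Real.exp ((t - t0) / 2) / 2) t := by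
      intro t
      have := (((hasDerivAt_id' t).sub_const t0).div_const 2).exp
      exact this.congr_deriv (by ring)
    have hE1 : ∀ t, (0:ℝ) < 1 + Real.exp ((t - t0) / 2) := fun t => by positivity
    have hd0 : ∀ t, HasDerivAt k0 (Real.exp ((t - t0) / 2) / (1 + Real.exp ((t - t0) / 2))) t := by
      intro t
      have := ((((hE t).const_add 1).log (hE1 t).ne').const_mul 2).sub_const (2 * Real.log 2)
      exact this.congr_deriv (by ring)
    have hd1 : deriv k0 = fun t => Real.exp ((t - t0) / 2) / (1 + Real.exp ((t - t0) / 2)) :=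
      funext fun t => (hd0 t).deriv
    have hd2 : ∀ t, deriv (deriv k0) t =
        Real.exp ((t - t0) / 2) / 2 / (1 + Real.exp ((t - t0) / 2)) ^ 2 := by
      intro t
      rw [hd1]
      rw [((hE t).fun_div ((hE t).const_add 1) (hE1 t).ne').deriv]
      congr 1; ring
    have hsm : ContDiff ℝ (⊤ : ℕ∞) k0 := by
      have h1 : ContDiff ℝ (⊤ : ℕ∞) fun t => 1 + Real.exp ((t - t0) / 2) := by fun_prop
      exact ((h1.log fun t => (hE1 t).ne').const_smul (2:ℝ) |>.sub contDiff_const)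
    have hneg : ∀ t ≤ t0, k0 t ≤ 0 := by
      intro t ht
      have : Real.exp ((t - t0) / 2) ≤ 1 := Real.exp_le_one_iff.2 (by linarith)
      have := Real.log_le_log (hE1 t) (show 1 + Real.exp ((t - t0) / 2) ≤ 2 by linarith)
      simp only [hk0]; linarith
    have hpos0 : ∀ t, t0 < t → 0 < k0 t := by
      intro t ht
      have : 1 < Real.exp ((t - t0) / 2) := Real.one_lt_exp_iff.2 (by linarith)
      have := Real.log_lt_log (by norm_num) (show 2 < 1 + Real.exp ((t - t0) / 2) by linarith)
      simp only [hk0]; linarith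
    have hub : ∀ t, t0 ≤ t → k0 t ≤ t - t0 := by
      intro t ht
      have : 1 ≤ Real.exp ((t - t0) / 2) := Real.one_le_exp (by linarith)
      have := Real.log_le_log (hE1 t)
        (show 1 + Real.exp ((t - t0) / 2) ≤ 2 * Real.exp ((t - t0) / 2) by linarith)
      rw [Real.log_mul (by norm_num) (Real.exp_pos _).ne', Real.log_exp] at this
      simp only [hk0]; linarith
    have hlb : ∀ t, t - t0 - 2 ≤ k0 t := by
      intro t
      have := Real.log_le_log (Real.exp_pos ((t - t0) / 2))
        (show Real.exp ((t - t0) / 2) ≤ 1 + Real.exp ((t - t0) / 2) by linarith)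
      rw [Real.log_exp] at this
      have h2 := Real.log_le_sub_one_of_pos (show (0:ℝ) < 2 by norm_num)
      simp only [hk0]; linarith
    have hdn : ∀ t, 0 ≤ deriv k0 t := by
      intro t; rw [hd1]; dsimp only; have := hE1 t; positivity
    have hdle : ∀ t, deriv k0 t ≤ 1 := by
      intro t; rw [hd1]; dsimp only; rw [div_le_one (hE1 t)]; linarith
    have hode : ∀ t, t0 < t → C * Real.exp (-t) * k0 t ≤
        deriv (deriv k0) t + 2 * 0 * deriv k0 t := by
      intro t ht
      rw [hd2]
      set E := Real.exp ((t - t0) / 2) with hEdef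
      have hE1 : 1 ≤ E := Real.one_le_exp (by linarith)
      have hEt : (t - t0) / 2 + 1 ≤ E := Real.add_one_le_exp _
      have hexp : Real.exp (-t) * (E * E) * Real.exp t0 = 1 := by
        rw [hEdef, ← Real.exp_add, ← Real.exp_add, ← Real.exp_add, ← Real.exp_zero]
        congr 1; ring
      have h3 : k0 t ≤ 2 * E := (hub t ht.le).trans (by linarith)
      have h4 : 16 * C * Real.exp (-t) * (E * E) ≤ 1 := by
        have : 16 * C * (Real.exp (-t) * (E * E)) ≤ Real.exp t0 * (Real.exp (-t) * (E * E)) := by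
          gcongr
        nlinarith
      have h5 : C * Real.exp (-t) * k0 t ≤ C * Real.exp (-t) * (2 * E) := by gcongr
      have h6 : C * Real.exp (-t) * (2 * E) ≤ 1 / (8 * E) := by
        rw [le_div_iff₀ (by positivity)]; nlinarith
      have h7 : 1 / (8 * E) ≤ E / 2 / (1 + E) ^ 2 := by
        rw [div_div, div_le_div_iff₀ (by positivity) (by positivity)]
        nlinarith
      linarith
    refine ⟨t0, 1, 2, max 1 (2 * |t0| + 6), fun t => hh 1 (k0 t), ht1, le_rfl, by norm_num,
      le_max_left _ _, lt_of_lt_of_le (by nlinarith [le_abs_self t0, abs_nonneg t0])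
        (le_max_right _ _), (hh_smooth 1).comp hsm,
      fun t ht => hh_nonpos one_pos (hneg t ht), ?_, ?_, ?_⟩
    · intro t ht
      dsimp only
      rw [hh_pos one_pos (hpos0 t ht)]; have := hpos0 t ht; positivity
    · intro t ht
      exact profile_comp hsm (hpos0 t ht) (hdn t) (hode t ht) hC
    · intro t ht
      have ht6 : 2 * |t0| + 6 ≤ t := (le_max_right _ _).trans ht
      have ha := le_abs_self t0
      have ha' := neg_abs_le t0
      have ht0 : t0 < t := by nlinarith [abs_nonneg t0]
      have hdd : deriv (fun s => hh 1 (k0 s)) t = deriv (hh 1) (k0 t) * deriv k0 t :=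
        ((hh_diff 1 (k0 t)).hasDerivAt.comp t (smooth_diff hsm t).hasDerivAt).deriv
      have hd1 := hh_deriv_nonneg one_pos (k0 t)
      have hd2 := hh_deriv_le_one one_pos (k0 t)
      have hd3 := hdn t
      have hd4 := hdle t
      have h5 := hh_le one_pos (hpos0 t ht0).le
      have h6 := hh_ge one_pos (hpos0 t ht0)
      have h7 := hub t ht0.le
      have h8 := hlb t
      rw [hdd]
      refine ⟨by positivity, ?_, ?_, ?_⟩
      · rw [pow_one]; linarith
      · rw [pow_one]
        have : deriv (hh 1) (k0 t) * deriv k0 t ≤ 1 := mul_le_one₀ hd2 hd3 hd4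
        have : deriv (hh 1) (k0 t) * deriv k0 t * t ≤ 1 * t := by
          gcongr
          linarith [abs_nonneg t0]
        linarith
      · simp
  · -- ν > 0
    set a := min ν 1 with ha
    have ha0 : 0 < a := lt_min hpos one_pos
    have ha1 : a ≤ 1 := min_le_right _ _
    have haν : a ≤ ν := min_le_left _ _
    obtain ⟨t0, ht1, ht2⟩ : ∃ t0, tmin ≤ t0 ∧ C / a ^ 2 ≤ Real.exp t0 := by
      have h := Real.tendsto_exp_atTop.eventually_ge_atTop (C / a ^ 2)
      obtain ⟨t0, h1, h2⟩ := (h.and (eventually_ge_atTop tmin)).exists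
      exact ⟨t0, h2, h1⟩
    rw [div_le_iff₀ (by positivity)] at ht2
    set k0 : ℝ → ℝ := fun t => 4 * (1 - Real.exp (-a * (t - t0))) with hk0
    have hE : ∀ t, HasDerivAt (fun t => Real.exp (-a * (t - t0))) (-a * Real.exp (-a * (t - t0))) t := by
      intro t
      have := (((hasDerivAt_id' t).sub_const t0).const_mul (-a)).exp
      exact this.congr_deriv (by ring)
    have hd1 : deriv k0 = fun t => 4 * a * Real.exp (-a * (t - t0)) :=
      funext fun t => (((hE t).const_sub 1).const_mul 4).deriv.trans (by ring)
    have hd2 : ∀ t, deriv (deriv k0) t = - (4 * a ^ 2 * Real.exp (-a * (t - t0))) := by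
      intro t
      rw [hd1, ((hE t).const_mul (4 * a)).deriv]; ring
    have hsm : ContDiff ℝ (⊤ : ℕ∞) k0 := by
      simp only [hk0]; fun_prop
    have hneg : ∀ t ≤ t0, k0 t ≤ 0 := by
      intro t ht
      have : 1 ≤ Real.exp (-a * (t - t0)) := Real.one_le_exp (by nlinarith)
      simp only [hk0]; linarith
    have hpos0 : ∀ t, t0 < t → 0 < k0 t := by
      intro t ht
      have : Real.exp (-a * (t - t0)) < 1 := Real.exp_lt_one_iff.2 (by nlinarith)
      simp only [hk0]; linarith
    have hub : ∀ t, k0 t ≤ 4 := by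
      intro t
      have := Real.exp_pos (-a * (t - t0))
      simp only [hk0]; linarith
    have hdn : ∀ t, 0 ≤ deriv k0 t := by
      intro t; rw [hd1]; positivity
    have hode : ∀ t, t0 < t → C * Real.exp (-t) * k0 t ≤
        deriv (deriv k0) t + 2 * ν * deriv k0 t := by
      intro t ht
      rw [hd2, hd1]
      dsimp only
      have h1 : Real.exp (-(t - t0)) ≤ Real.exp (-a * (t - t0)) := Real.exp_le_exp.2 (by nlinarith)
      have h2 : Real.exp (-(t - t0)) = Real.exp t0 * Real.exp (-t) := by
        rw [← Real.exp_add]; congr 1; ring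
      have h3 : C * Real.exp (-t) * k0 t ≤ C * Real.exp (-t) * 4 := by
        have := hub t; gcongr
      have h4 : C * Real.exp (-t) ≤ Real.exp t0 * a ^ 2 * Real.exp (-t) := by gcongr
      have h5 : a ^ 2 * Real.exp (-(t - t0)) ≤ a ^ 2 * Real.exp (-a * (t - t0)) := by gcongr
      have h6 : a ^ 2 * Real.exp (-a * (t - t0)) ≤ ν * a * Real.exp (-a * (t - t0)) := by
        gcongr; nlinarith
      rw [h2] at h5
      nlinarith
    refine ⟨t0, 0, 4 + 4 * a + ν, max 1 (t0 + 1 / a), fun t => hh 1 (k0 t), ht1, by norm_num,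
      by positivity, le_max_left _ _, lt_of_lt_of_le (by have : 0 < 1 / a := by positivity
                                                         linarith)
        (le_max_right _ _), (hh_smooth 1).comp hsm,
      fun t ht => hh_nonpos one_pos (hneg t ht), ?_, ?_, ?_⟩
    · intro t ht
      dsimp only
      rw [hh_pos one_pos (hpos0 t ht)]; have := hpos0 t ht; positivity
    · intro t ht
      exact profile_comp hsm (hpos0 t ht) (hdn t) (hode t ht) hC
    · intro t ht
      have ht6 : t0 + 1 / a ≤ t := (le_max_right _ _).trans ht
      have h1a : 0 < 1 / a := by positivity
      have ht0 : t0 < t := by linarith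
      have hdd : deriv (fun s => hh 1 (k0 s)) t = deriv (hh 1) (k0 t) * deriv k0 t :=
        ((hh_diff 1 (k0 t)).hasDerivAt.comp t (smooth_diff hsm t).hasDerivAt).deriv
      have hd1' := hh_deriv_nonneg one_pos (k0 t)
      have hd2' := hh_deriv_le_one one_pos (k0 t)
      have hd3 := hdn t
      have h5 := hh_le one_pos (hpos0 t ht0).le
      have h6 := hh_ge one_pos (hpos0 t ht0)
      have h7 := hub t
      have hat : 1 ≤ a * (t - t0) := by
        have : a * (1 / a) ≤ a * (t - t0) := by gcongr; linarith
        rwa [mul_one_div_cancel ha0.ne'] at this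
      have hexp : Real.exp (-a * (t - t0)) ≤ 1 / 2 := by
        have h1 : Real.exp (-a * (t - t0)) ≤ Real.exp (-1) := Real.exp_le_exp.2 (by linarith)
        have h2 : (2:ℝ) ≤ Real.exp 1 := by
          have := Real.add_one_le_exp (1:ℝ); linarith
        rw [Real.exp_neg] at h1
        have : (Real.exp 1)⁻¹ ≤ 1 / 2 := by rw [one_div]; gcongr
        linarith
      have hk1 : 1 ≤ hh 1 (k0 t) := by
        have : 2 ≤ k0 t := by simp only [hk0]; linarith
        linarith
      have hd4 : deriv k0 t ≤ 4 * a := by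
        rw [hd1]; dsimp only
        have := Real.exp_pos (-a * (t - t0))
        nlinarith
      rw [hdd]
      refine ⟨by positivity, ?_, ?_, ?_⟩
      · rw [pow_zero]; linarith
      · rw [pow_zero]
        have : deriv (hh 1) (k0 t) * deriv k0 t ≤ 1 * (4 * a) := by gcongr
        nlinarith
      · rw [pow_zero]; linarith

lemma exists_cutoff (n : ℕ) : ∃ (ζ : ℝ → ℝ) (A : ℝ), 0 < A ∧ ContDiff ℝ (⊤ : ℕ∞) ζ ∧
    (∀ s ≤ 1, ζ s = 1) ∧ (∀ s, 2 ≤ s → ζ s = 0) ∧ (∀ s, 0 ≤ ζ s ∧ ζ s ≤ 1) ∧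
    (∀ s, |deriv (fun s => ζ s ^ (n + 2)) s| ≤ A * ζ s ^ n) ∧
    (∀ s, |deriv (deriv (fun s => ζ s ^ (n + 2))) s| ≤ A * ζ s ^ n) ∧
    (∀ s ≤ 1, deriv (fun s => ζ s ^ (n + 2)) s = 0) ∧
    (∀ s ≤ 1, deriv (deriv (fun s => ζ s ^ (n + 2))) s = 0) := by
  set ζ : ℝ → ℝ := fun s => Real.smoothTransition (2 - s) with hζ
  have hsm : ContDiff ℝ (⊤ : ℕ∞) ζ := Real.smoothTransition.contDiff.comp (by fun_prop)
  have hsm1 := contDiff_deriv2 hsm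
  have hsm2 := contDiff_deriv2 hsm1
  have h1 : ∀ s ≤ 1, ζ s = 1 := fun s hs => Real.smoothTransition.one_of_one_le (by linarith)
  have h2 : ∀ s, 2 ≤ s → ζ s = 0 := fun s hs => Real.smoothTransition.zero_of_nonpos (by linarith)
  have h01 : ∀ s, 0 ≤ ζ s ∧ ζ s ≤ 1 := fun s =>
    ⟨Real.smoothTransition.nonneg _, Real.smoothTransition.le_one _⟩
  have left : ∀ (f : ℝ → ℝ) (c : ℝ), Differentiable ℝ f → (∀ s ≤ 1, f s = c) →
      ∀ s ≤ 1, deriv f s = 0 := by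
    intro f c hf h0 s hs
    have h1 : HasDerivWithinAt f (deriv f s) (Set.Iic s) s := (hf s).hasDerivAt.hasDerivWithinAt
    have h2 : HasDerivWithinAt f 0 (Set.Iic s) s :=
      (hasDerivWithinAt_const s (Set.Iic s) c).congr (fun y hy => h0 y (le_trans hy hs)) (h0 s hs)
    exact (uniqueDiffWithinAt_Iic s).eq_deriv _ h1 h2
  have right : ∀ (f : ℝ → ℝ), Differentiable ℝ f → (∀ s, 2 ≤ s → f s = 0) →
      ∀ s, 2 ≤ s → deriv f s = 0 := by
    intro f hf h0 s hs
    have h1 : HasDerivWithinAt f (deriv f s) (Set.Ici s) s := (hf s).hasDerivAt.hasDerivWithinAt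
    have h2 : HasDerivWithinAt f 0 (Set.Ici s) s :=
      (hasDerivWithinAt_const s (Set.Ici s) (0:ℝ)).congr (fun y hy => h0 y (le_trans hs hy)) (h0 s hs)
    exact (uniqueDiffWithinAt_Ici s).eq_deriv _ h1 h2
  have l1 := left ζ 1 (smooth_diff hsm) h1
  have l2 := left (deriv ζ) 0 (smooth_diff hsm1) l1
  have r1 := right ζ (smooth_diff hsm) h2
  have r2 := right (deriv ζ) (smooth_diff hsm1) r1
  have bd : ∀ f : ℝ → ℝ, Continuous f → (∀ s ≤ 1, f s = 0) → (∀ s, 2 ≤ s → f s = 0) →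
      ∃ B, 0 ≤ B ∧ ∀ s, |f s| ≤ B := by
    intro f hf hl hr
    obtain ⟨B, hB⟩ := (isCompact_Icc (a := (1:ℝ)) (b := 2)).exists_bound_of_continuousOn hf.continuousOn
    refine ⟨max B 0, le_max_right _ _, fun s => ?_⟩
    by_cases hs1 : s ≤ 1
    · rw [hl s hs1]; simp
    by_cases hs2 : 2 ≤ s
    · rw [hr s hs2]; simp
    exact (hB s ⟨by linarith, by linarith⟩).trans (le_max_left _ _)
  obtain ⟨B1, hB1, hb1⟩ := bd (deriv ζ) hsm1.continuous l1 r1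
  obtain ⟨B2, hB2, hb2⟩ := bd (deriv (deriv ζ)) hsm2.continuous l2 r2
  have d1 : deriv (fun s => ζ s ^ (n + 2)) = fun s => ((n:ℝ) + 2) * ζ s ^ (n + 1) * deriv ζ s := by
    funext s
    rw [((smooth_diff hsm s).hasDerivAt.fun_pow (n + 2)).deriv]
    push_cast; simp
  have d2 : deriv (deriv (fun s => ζ s ^ (n + 2))) = fun s =>
      ((n:ℝ) + 2) * ζ s ^ n * (((n:ℝ) + 1) * deriv ζ s ^ 2 + ζ s * deriv (deriv ζ) s) := by
    rw [d1]
    funext s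
    have := ((((smooth_diff hsm s).hasDerivAt.fun_pow (n + 1)).const_mul ((n:ℝ) + 2)).fun_mul
      (smooth_diff hsm1 s).hasDerivAt).deriv
    rw [this]
    push_cast; ring_nf
  refine ⟨ζ, ((n:ℝ) + 2) * (((n:ℝ) + 1) * B1 ^ 2 + B2) + ((n:ℝ) + 2) * B1 + 1, by positivity, hsm, h1, h2, h01,
    ?_, ?_, ?_, ?_⟩
  · intro s
    rw [d1]; dsimp only
    have hz := h01 s
    have hz0 := hz.1
    rw [abs_mul, abs_mul, abs_of_nonneg (by positivity : 0 ≤ ((n:ℝ) + 2)), abs_of_nonneg (by positivity), pow_succ]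
    calc ((n:ℝ) + 2) * (ζ s ^ n * ζ s) * |deriv ζ s| ≤ ((n:ℝ) + 2) * (ζ s ^ n * 1) * B1 := by
          gcongr
          · exact hz.2
          · exact hb1 s
      _ = ((n:ℝ) + 2) * B1 * ζ s ^ n := by ring
      _ ≤ _ := by
          gcongr
          have : 0 ≤ ((n:ℝ) + 2) * (((n:ℝ) + 1) * B1 ^ 2 + B2) := by positivity
          linarith
  · intro s
    rw [d2]; dsimp only
    have hz := h01 s
    have hz0 := hz.1
    rw [abs_mul, abs_of_nonneg (by positivity : 0 ≤ ((n:ℝ) + 2) * ζ s ^ n)]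
    have h3 : |((n:ℝ) + 1) * deriv ζ s ^ 2 + ζ s * deriv (deriv ζ) s| ≤ ((n:ℝ) + 1) * B1 ^ 2 + B2 := by
      refine (abs_add_le _ _).trans ?_
      rw [abs_mul, abs_mul, abs_of_nonneg (by positivity : 0 ≤ ((n:ℝ) + 1)), abs_pow, abs_of_nonneg hz0]
      have e1 : |deriv ζ s| ^ 2 ≤ B1 ^ 2 := by have := hb1 s; gcongr
      have e2 : ζ s * |deriv (deriv ζ) s| ≤ 1 * B2 := by have := hb2 s; have := hz.2; gcongr
      have : ((n:ℝ) + 1) * |deriv ζ s| ^ 2 ≤ ((n:ℝ) + 1) * B1 ^ 2 := by gcongr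
      linarith
    calc _ ≤ ((n:ℝ) + 2) * ζ s ^ n * (((n:ℝ) + 1) * B1 ^ 2 + B2) := by gcongr
      _ = (((n:ℝ) + 2) * (((n:ℝ) + 1) * B1 ^ 2 + B2)) * ζ s ^ n := by ring
      _ ≤ _ := by
          gcongr
          have : 0 ≤ ((n:ℝ) + 2) * B1 := by positivity
          linarith
  · intro s hs; rw [d1]; dsimp only; rw [l1 s hs]; simp
  · intro s hs; rw [d2]; dsimp only; rw [l1 s hs, l2 s hs]; simp

lemma cutoff_profile {ν C t0 : ℝ} {θ : ℕ} {M T0 : ℝ} {k : ℝ → ℝ} (hθ : θ ≤ 1) (hν : 0 ≤ ν)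
    (hM : 0 < M) (hT0 : 1 ≤ T0) (hk : IsProfile ν C t0 θ M T0 k) (n : ℕ) {ζ : ℝ → ℝ} {A : ℝ}
    (hA : 0 < A) (hsm : ContDiff ℝ (⊤ : ℕ∞) ζ) (h01 : ∀ s, 0 ≤ ζ s ∧ ζ s ≤ 1)
    (hζ1 : ∀ s, |deriv (fun s => ζ s ^ (n + 2)) s| ≤ A * ζ s ^ n)
    (hζ2 : ∀ s, |deriv (deriv (fun s => ζ s ^ (n + 2))) s| ≤ A * ζ s ^ n)
    (hl1 : ∀ s ≤ 1, deriv (fun s => ζ s ^ (n + 2)) s = 0)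
    (hl2 : ∀ s ≤ 1, deriv (deriv (fun s => ζ s ^ (n + 2))) s = 0)
    {T : ℝ} (hT : T0 ≤ T) {t : ℝ} (ht : t0 < t) :
    C * Real.exp (-t) * (k t * ζ (t / T) ^ (n + 2))
      - (if T ≤ t then A * (4 * M + 1) / T ^ (1 + θ) * (k t * ζ (t / T) ^ n) else 0) ≤
    deriv (deriv fun s => k s * ζ (s / T) ^ (n + 2)) t
      + 2 * ν * deriv (fun s => k s * ζ (s / T) ^ (n + 2)) t := by
  obtain ⟨hks, hk0, hkpos, hode, hkT⟩ := hk
  have hTpos : 0 < T := by linarith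
  set η : ℝ → ℝ := fun s => ζ s ^ (n + 2) with hη
  have hηs : ContDiff ℝ (⊤ : ℕ∞) η := hsm.pow _
  have dη : ∀ s, HasDerivAt (fun s => η (s / T)) (deriv η (s / T) / T) s := fun s => by
    have := (smooth_diff hηs (s / T)).hasDerivAt.comp s ((hasDerivAt_id' s).div_const T)
    exact this.congr_deriv (by ring)
  have dη2 : ∀ s, HasDerivAt (fun s => deriv η (s / T) / T) (deriv (deriv η) (s / T) / T ^ 2) s :=
    fun s => by
    have := ((smooth_diff (contDiff_deriv2 hηs) (s / T)).hasDerivAt.comp s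
      ((hasDerivAt_id' s).div_const T)).div_const T
    exact this.congr_deriv (by field_simp)
  have dk := fun s => (smooth_diff hks s).hasDerivAt
  have dk2 := fun s => (smooth_diff (contDiff_deriv2 hks) s).hasDerivAt
  have e1 : deriv (fun s => k s * η (s / T)) =
      fun s => deriv k s * η (s / T) + k s * (deriv η (s / T) / T) :=
    funext fun s => ((dk s).fun_mul (dη s)).deriv
  have e2 : deriv (deriv fun s => k s * η (s / T)) t = deriv (deriv k) t * η (t / T)
      + deriv k t * (deriv η (t / T) / T) + (deriv k t * (deriv η (t / T) / T)
      + k t * (deriv (deriv η) (t / T) / T ^ 2)) := by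
    rw [e1]
    exact (((dk2 t).fun_mul (dη t)).fun_add ((dk t).fun_mul (dη2 t))).deriv
  change C * Real.exp (-t) * (k t * η (t / T)) - _ ≤ deriv (deriv fun s => k s * η (s / T)) t
      + 2 * ν * deriv (fun s => k s * η (s / T)) t
  rw [e2, e1]
  dsimp only
  have hη0 : 0 ≤ η (t / T) := pow_nonneg (h01 _).1 _
  have hmain := mul_le_mul_of_nonneg_right (hode t ht) hη0
  split_ifs with hTt
  · obtain ⟨hk', hk1, hk2, hk3⟩ := hkT t (hT.trans hTt)
    have hkp := hkpos t ht
    have hν3 := (hkT T hT).2.2.2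
    set z := ζ (t / T) ^ n with hz
    have hz0 : 0 ≤ z := pow_nonneg (h01 _).1 _
    have a1 := hζ1 (t / T)
    have a2 := hζ2 (t / T)
    have hT1 : 1 ≤ T := hT0.trans hT
    have hTθ : 0 < T ^ θ := by positivity
    have b1 : deriv k t * T ^ θ ≤ M * k t := by
      refine le_trans ?_ hk2
      gcongr
    have c1 : deriv k t * |deriv η (t / T)| / T ≤ M * A / T ^ (1 + θ) * (k t * z) := by
      rw [pow_add, pow_one]
      have : deriv k t ≤ M * k t / T ^ θ := by rwa [le_div_iff₀ hTθ]
      calc _ ≤ (M * k t / T ^ θ) * (A * z) / T := by gcongr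
        _ = _ := by field_simp
    have c2 : ν * k t * |deriv η (t / T)| / T ≤ M * A / T ^ (1 + θ) * (k t * z) := by
      rw [pow_add, pow_one]
      have : ν ≤ M / T ^ θ := by rwa [le_div_iff₀ hTθ]
      calc _ ≤ (M / T ^ θ) * k t * (A * z) / T := by gcongr
        _ = _ := by field_simp
    have c3 : k t * |deriv (deriv η) (t / T)| / T ^ 2 ≤ A / T ^ (1 + θ) * (k t * z) := by
      have : T ^ (1 + θ) ≤ T ^ 2 := pow_le_pow_right₀ hT1 (by omega)
      calc _ ≤ k t * (A * z) / T ^ (1 + θ) := by gcongr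
        _ = _ := by ring
    have d1 : -(deriv k t * |deriv η (t / T)| / T) ≤ deriv k t * (deriv η (t / T) / T) := by
      have : -(deriv k t * |deriv η (t / T)| / T) = deriv k t * (-|deriv η (t / T)| / T) := by ring
      rw [this]; gcongr; exact neg_abs_le _
    have d2 : -(ν * k t * |deriv η (t / T)| / T) ≤ ν * (k t * (deriv η (t / T) / T)) := by
      have : -(ν * k t * |deriv η (t / T)| / T) = ν * (k t * (-|deriv η (t / T)| / T)) := by ring
      rw [this]; gcongr; exact neg_abs_le _
    have d3 : -(k t * |deriv (deriv η) (t / T)| / T ^ 2) ≤ k t * (deriv (deriv η) (t / T) / T ^ 2) := by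
      have : -(k t * |deriv (deriv η) (t / T)| / T ^ 2) = k t * (-|deriv (deriv η) (t / T)| / T ^ 2) := by ring
      rw [this]; gcongr; exact neg_abs_le _
    have e : A * (4 * M + 1) / T ^ (1 + θ) * (k t * z) =
      4 * (M * A / T ^ (1 + θ) * (k t * z)) + A / T ^ (1 + θ) * (k t * z) := by ring
    rw [e]
    nlinarith
  · have hs : t / T ≤ 1 := by rw [div_le_one hTpos]; linarith
    rw [hl1 _ hs, hl2 _ hs]
    simp only [zero_div, mul_zero, add_zero, sub_zero]
    nlinarith

lemma two_le_smooth : (2 : WithTop ℕ∞) ≤ ((⊤ : ℕ∞) : WithTop ℕ∞) :=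
  WithTop.coe_le_coe.2 (le_top : (2 : ℕ∞) ≤ ⊤)

/-! ### Interior ball -/

lemma interior_ball {N : ℕ} (i0 : Fin N) {Ω : Set (Euc N)} (hΩ : IsSmoothDomain Ω)
    (hhalf : ∀ x ∈ Ω, 0 < x i0) (h0 : (0 : Euc N) ∈ frontier Ω) :
    ∃ K > 0, ∃ ρ > 0, ∀ y : Euc N, y ≠ 0 → ‖y‖ ≤ ρ → K * ‖y‖ ^ 2 ≤ y i0 → y ∈ Ω := by
  obtain ⟨-, -, -, h⟩ := hΩ
  obtain ⟨U, f, hU, hxU, hf, hdf, hin, hfr⟩ := h 0 h0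
  have hf0 : f 0 = 0 := by
    have : (0 : Euc N) ∈ {y ∈ U | f y = 0} := hfr ▸ ⟨h0, hxU⟩
    exact this.2
  have hmem : ∀ y ∈ U, f y < 0 → y ∈ Ω := fun y hy hfy => by
    have : y ∈ Ω ∩ U := by rw [hin]; exact ⟨hy, hfy⟩
    exact this.1
  set L := fderiv ℝ f 0 with hL
  have hfd : DifferentiableAt ℝ f 0 := hf.differentiable (by simp) 0
  have key : ∀ v : Euc N, L v < 0 → 0 < v i0 := by
    intro v hv
    have h1 : HasDerivAt (fun t : ℝ => f (t • v)) (L v) 0 := by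
      have h2 : HasFDerivAt f L ((0 : ℝ) • v) := by rw [zero_smul]; exact hfd.hasFDerivAt
      have h3 : HasDerivAt (fun t : ℝ => t • v) v 0 := by
        simpa using (hasDerivAt_id (0 : ℝ)).smul_const v
      exact h2.comp_hasDerivAt (0 : ℝ) h3
    have h4 : ∀ᶠ t in 𝓝[>] (0 : ℝ), f (t • v) < 0 := by
      have := h1.tendsto_slope_zero_right
      have h5 := this.eventually (gt_mem_nhds hv)
      filter_upwards [h5, self_mem_nhdsWithin] with t ht ht0
      simp only [zero_add, zero_smul, hf0, sub_zero, smul_eq_mul] at ht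
      have ht0' : (0 : ℝ) < t := ht0
      by_contra hcon
      push Not at hcon
      have : 0 ≤ t⁻¹ * f (t • v) := by positivity
      linarith
    have h5 : ∀ᶠ t in 𝓝[>] (0 : ℝ), t • v ∈ U := by
      apply Filter.Eventually.filter_mono nhdsWithin_le_nhds
      have : ContinuousAt (fun t : ℝ => t • v) 0 := by fun_prop
      apply this.eventually_mem
      rw [zero_smul]
      exact hU.mem_nhds hxU
    obtain ⟨t, ⟨ht1, ht2⟩, ht3⟩ := ((h4.and h5).and self_mem_nhdsWithin).exists
    have ht3' : (0 : ℝ) < t := ht3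
    have := hhalf _ (hmem _ ht2 ht1)
    simp only [PiLp.smul_apply, smul_eq_mul] at this
    exact (mul_pos_iff_of_pos_left ht3').1 this
  set e : Euc N := EuclideanSpace.single i0 1 with he
  have hei : e i0 = 1 := by simp [he]
  have hker : ∀ v : Euc N, v i0 = 0 → L v = 0 := by
    intro v hv
    by_contra hne
    rcases lt_or_gt_of_ne hne with h | h
    · have := key v h; linarith
    · have := key (-v) (by simpa using h)
      simp [hv] at this
  have hLv : ∀ v : Euc N, L v = v i0 * L e := by
    intro v
    have := hker (v - v i0 • e) (by simp [hei])
    simp only [map_sub, map_smul, smul_eq_mul] at this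
    linarith
  have hLe : L e < 0 := by
    rcases lt_trichotomy (L e) 0 with h | h | h
    · exact h
    · exfalso
      apply hdf 0 hxU
      ext v
      rw [← hL, hLv v, h]; simp
    · exfalso
      have := key (-e) (by simpa using h)
      simp [hei] at this
      linarith
  obtain ⟨Kl, s, hs, hlip⟩ := (ContDiff.fderiv_right (m := 1) hf (by
    show (1 : WithTop ℕ∞) + 1 ≤ _
    norm_num; exact two_le_smooth)).contDiffAt.exists_lipschitzOnWith (x := (0 : Euc N)) 
  obtain ⟨ε, hε, hball⟩ := Metric.mem_nhds_iff.1 (Filter.inter_mem hs (hU.mem_nhds hxU))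
  have hbound : ∀ y : Euc N, ‖y‖ < ε → f y ≤ y i0 * L e + Kl * ‖y‖ * ‖y‖ := by
    intro y hy
    have hsub : closedBall (0 : Euc N) ‖y‖ ⊆ s := by
      intro z hz
      exact (hball (by rw [mem_ball_zero_iff]; rw [mem_closedBall_zero_iff] at hz; linarith)).1
    have := Convex.norm_image_sub_le_of_norm_fderiv_le' (𝕜 := ℝ) (f := f) (C := Kl * ‖y‖) (φ := L)
      (s := closedBall (0 : Euc N) ‖y‖) (x := 0) (y := y)
      (fun z _ => hf.differentiable (by simp) z)
      (fun z hz => by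
        have h1 := hlip.dist_le_mul z (hsub hz) 0 (mem_of_mem_nhds hs)
        rw [dist_eq_norm, dist_zero_right] at h1
        refine h1.trans ?_
        gcongr
        simpa using hz)
      (convex_closedBall _ _) (by simp) (by simp)
    rw [hf0, sub_zero, sub_zero, hLv y, Real.norm_eq_abs] at this
    have := le_abs_self (f y - y i0 * L e)
    linarith
  have hKl : (0 : ℝ) ≤ Kl := Kl.2
  refine ⟨(Kl + 1) / (-L e), by apply div_pos <;> linarith, ε / 2, by linarith, fun y hy hyr hyK => ?_⟩
  have hyn : 0 < ‖y‖ := norm_pos_iff.2 hy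
  have hyε : ‖y‖ < ε := by linarith
  refine hmem y (hball (by simpa using hyε)).2 ?_
  have h1 := hbound y hyε
  have h2 : (Kl + 1) * ‖y‖ ^ 2 ≤ y i0 * (-L e) := by
    have := mul_le_mul_of_nonneg_right hyK (by linarith : 0 ≤ -L e)
    calc (Kl + 1) * ‖y‖ ^ 2 = (Kl + 1) / (-L e) * ‖y‖ ^ 2 * (-L e) := by
          have h9 : L e ≠ 0 := hLe.ne
          field_simp
      _ ≤ _ := this
  nlinarith [sq_nonneg ‖y‖, pow_pos hyn 2]

/-! ### Integrability against test functions -/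

lemma lap_zero_off {N : ℕ} {φ : Euc N → ℝ} {x : Euc N} (hx : x ∉ tsupport φ) : lap φ x = 0 := by
  have : iteratedFDeriv ℝ 2 φ x = 0 := by
    by_contra h
    exact hx (support_iteratedFDeriv_subset (𝕜 := ℝ) 2 h)
  simp [lap, this]

lemma lap_continuous {N : ℕ} {φ : Euc N → ℝ} (h : ContDiff ℝ (⊤ : ℕ∞) φ) : Continuous (lap φ) := by
  unfold lap
  have := h.continuous_iteratedFDeriv (m := 2) two_le_smooth
  refine continuous_finsetSum _ fun i _ => ?_
  fun_prop

lemma integrable_test {N : ℕ} {Ω : Set (Euc N)} {g ψ : Euc N → ℝ}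
    (hg : LocallyIntegrableOn g Ω volume) (hψ : Continuous ψ) {S : Set (Euc N)} (hS : IsCompact S)
    (hSΩ : S ⊆ Ω) (h0 : ∀ x, x ∉ S → ψ x = 0) : Integrable (fun x => g x * ψ x) := by
  have h1 : IntegrableOn g S := hg.integrableOn_compact_subset hSΩ hS
  have h2 : IntegrableOn (fun x => g x * ψ x) S := h1.mul_continuousOn hψ.continuousOn hS
  rwa [integrableOn_iff_integrable_of_support_subset] at h2
  intro x hx
  by_contra h
  exact hx (by simp [h0 x h])

lemma integrable_u_lap {N : ℕ} {Ω : Set (Euc N)} {g φ : Euc N → ℝ}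
    (hg : LocallyIntegrableOn g Ω volume) (hφ : IsTestFun Ω φ) :
    Integrable (fun x => g x * lap φ x) :=
  integrable_test hg (lap_continuous hφ.1) hφ.2.1 hφ.2.2 fun _ hx => lap_zero_off hx

lemma integrable_u_test {N : ℕ} {Ω : Set (Euc N)} {g φ : Euc N → ℝ}
    (hg : LocallyIntegrableOn g Ω volume) (hφ : IsTestFun Ω φ) :
    Integrable (fun x => g x * φ x) :=
  integrable_test hg hφ.1.continuous hφ.2.1 hφ.2.2 fun _ hx => image_eq_zero_of_notMem_tsupport hx

/-! ### Propagation of the zero set -/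

lemma bump_profile (N : ℕ) {r R : ℝ} (hr : 0 < r) (hrR : r < R) :
    ∃ F : ℝ → ℝ, ContDiff ℝ (⊤ : ℕ∞) F ∧ (∀ s ≤ 0, F s = 0) ∧ (∀ s, 0 < s → 0 < F s) ∧
      ∀ s ρ2, s ≤ R ^ 2 → r ^ 2 ≤ ρ2 → 2 * N * deriv F s ≤ 4 * ρ2 * deriv (deriv F) s := by
  have hR : 0 < R := hr.trans hrR
  obtain ⟨τ, hτ, hτ1, hτ2⟩ : ∃ τ > 0, 4 * R ^ 2 * τ ≤ 1 ∧ N * R ^ 4 * τ ≤ r ^ 2 := by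
    refine ⟨min (1 / (4 * R ^ 2)) (r ^ 2 / ((N + 1) * R ^ 4)), by positivity, ?_, ?_⟩
    · calc _ ≤ 4 * R ^ 2 * (1 / (4 * R ^ 2)) := by gcongr; exact min_le_left _ _
        _ = 1 := by field_simp
    · calc _ ≤ (N + 1) * R ^ 4 * (r ^ 2 / ((N + 1) * R ^ 4)) := by
            gcongr
            · linarith
            · exact min_le_right _ _
        _ = _ := by field_simp
  have hsm : ContDiff ℝ (⊤ : ℕ∞) fun s : ℝ => expNegInvGlue (τ * s) :=
    (expNegInvGlue.contDiff (n := (⊤ : ℕ∞))).comp (contDiff_const.mul contDiff_id)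
  have hz : ∀ s ≤ 0, expNegInvGlue (τ * s) = 0 := fun s hs =>
    expNegInvGlue.zero_of_nonpos (mul_nonpos_of_nonneg_of_nonpos hτ.le hs)
  refine ⟨_, hsm, hz, fun s hs => expNegInvGlue.pos_of_pos (by positivity), ?_⟩
  intro s ρ2 hsR hρ
  have hd := deriv_zero_left (smooth_diff hsm) hz
  have hdd := deriv_zero_left (smooth_diff (contDiff_deriv2 hsm)) hd
  rcases le_or_gt s 0 with hs | hs
  · rw [hd s hs, hdd s hs]; simp
  have hF : ∀ y : ℝ, 0 < y → expNegInvGlue (τ * y) = Real.exp (-(τ * y)⁻¹) := fun y hy => by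
    unfold expNegInvGlue
    rw [if_neg (not_le.2 (by positivity))]
  have hinv : ∀ y : ℝ, 0 < y → HasDerivAt (fun y : ℝ => -(τ * y)⁻¹) ((τ * y ^ 2)⁻¹) y := fun y hy => by
    have h1 : HasDerivAt (fun y : ℝ => τ * y) τ y := by simpa using (hasDerivAt_id y).const_mul τ
    refine ((h1.fun_inv (by positivity)).neg).congr_deriv ?_
    field_simp
  have hD : ∀ y : ℝ, 0 < y → deriv (fun s : ℝ => expNegInvGlue (τ * s)) y
      = Real.exp (-(τ * y)⁻¹) * (τ * y ^ 2)⁻¹ := fun y hy => by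
    have h3 : (fun s : ℝ => expNegInvGlue (τ * s)) =ᶠ[𝓝 y] (fun s : ℝ => Real.exp (-(τ * s)⁻¹)) := by
      filter_upwards [lt_mem_nhds hy] with z hz using hF z hz
    rw [h3.deriv_eq]
    exact ((hinv y hy).exp).deriv
  have hDD : deriv (deriv (fun s : ℝ => expNegInvGlue (τ * s))) s
      = Real.exp (-(τ * s)⁻¹) * (τ * s ^ 2)⁻¹ * (τ * s ^ 2)⁻¹
        + Real.exp (-(τ * s)⁻¹) * (-(τ * (2 * s)) / (τ * s ^ 2) ^ 2) := by
    have h3 : deriv (fun s : ℝ => expNegInvGlue (τ * s)) =ᶠ[𝓝 s]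
        (fun s : ℝ => Real.exp (-(τ * s)⁻¹) * (τ * s ^ 2)⁻¹) := by
      filter_upwards [lt_mem_nhds hs] with z hz using hD z hz
    rw [h3.deriv_eq]
    have h1 : HasDerivAt (fun y : ℝ => τ * y ^ 2) (τ * (2 * s)) s := by
      simpa using (hasDerivAt_pow 2 s).const_mul τ
    exact ((hinv s hs).exp.fun_mul (h1.fun_inv (by positivity))).deriv
  rw [hD s hs, hDD]
  have hE := Real.exp_pos (-(τ * s)⁻¹)
  generalize Real.exp (-(τ * s)⁻¹) = E at *
  have h1 : 4 * ρ2 * (E * (τ * s ^ 2)⁻¹ * (τ * s ^ 2)⁻¹ + E * (-(τ * (2 * s)) / (τ * s ^ 2) ^ 2))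
      - 2 * N * (E * (τ * s ^ 2)⁻¹) = E * (τ * s ^ 2)⁻¹ * (τ * s ^ 2)⁻¹ *
        (4 * ρ2 * (1 - 2 * (τ * s)) - 2 * N * τ * s ^ 2) := by
    field_simp
    ring
  have h2 : 2 * (τ * s) ≤ 1 / 2 := by nlinarith
  have h3 : 2 * N * τ * s ^ 2 ≤ 2 * r ^ 2 := by
    have : s ^ 2 ≤ (R ^ 2) ^ 2 := by gcongr
    calc 2 * N * τ * s ^ 2 ≤ 2 * N * τ * (R ^ 2) ^ 2 := by gcongr
      _ = 2 * (N * R ^ 4 * τ) := by ring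
      _ ≤ _ := by gcongr
  have h4 : 0 ≤ 4 * ρ2 * (1 - 2 * (τ * s)) - 2 * N * τ * s ^ 2 := by
    nlinarith [sq_nonneg r]
  have h5 : 0 ≤ E * (τ * s ^ 2)⁻¹ * (τ * s ^ 2)⁻¹ *
        (4 * ρ2 * (1 - 2 * (τ * s)) - 2 * N * τ * s ^ 2) := by positivity
  linarith

lemma lap_translate {N : ℕ} (g : Euc N → ℝ) (a x : Euc N) :
    lap (fun y => g (y - a)) x = lap g (x - a) := by
  unfold lap
  simp_rw [iteratedFDeriv_comp_sub]

lemma exists_bump {N : ℕ} (i0 : Fin N) (a : Euc N) {r R : ℝ} (hr : 0 < r) (hrR : r < R) :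
    ∃ φ : Euc N → ℝ, ContDiff ℝ (⊤ : ℕ∞) φ ∧ (∀ x, 0 ≤ φ x) ∧ (∀ x ∈ ball a R, 0 < φ x) ∧
      (tsupport φ ⊆ closedBall a R) ∧ ∀ x ∉ ball a r, 0 ≤ lap φ x := by
  obtain ⟨F, hF, hF0, hFp, hFl⟩ := bump_profile N hr hrR
  have hR : 0 < R := hr.trans hrR
  have hsm : ContDiff ℝ (⊤ : ℕ∞) fun x : Euc N => F (R ^ 2 - ‖x - a‖ ^ 2) :=
    hF.comp (contDiff_const.sub ((contDiff_id.sub contDiff_const).norm_sq ℝ))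
  refine ⟨_, hsm, fun x => ?_, fun x hx => ?_, ?_, fun x hx => ?_⟩
  · rcases le_or_gt (R ^ 2 - ‖x - a‖ ^ 2) 0 with h | h
    · rw [hF0 _ h]
    · exact (hFp _ h).le
  · apply hFp
    rw [mem_ball_iff_norm] at hx
    nlinarith [norm_nonneg (x - a)]
  · apply closure_minimal _ isClosed_closedBall
    intro x hx
    by_contra h
    apply hx
    apply hF0
    rw [mem_closedBall_iff_norm, not_le] at h
    nlinarith [norm_nonneg (x - a)]
  · rw [lap_translate (fun y => F (R ^ 2 - ‖y‖ ^ 2))]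
    set y := x - a with hy
    have hyr : r ≤ ‖y‖ := by
      rw [mem_ball_iff_norm, not_lt] at hx; exact hx
    have h := (jet_lin i0 y (R ^ 2) 0 (-1)).comp (F := F) (Fd := deriv F)
      (Fdd := deriv (deriv F) (R ^ 2 + 0 * y i0 + (-1) * ‖y‖ ^ 2))
      (hF.of_le two_le_smooth).contDiffAt
      (Eventually.of_forall fun z => (smooth_diff hF z).hasDerivAt)
      (smooth_diff (contDiff_deriv2 hF) _).hasDerivAt
    have h2 := (h.congr (g := fun y => F (R ^ 2 - ‖y‖ ^ 2)) (fun y => by congr 1; ring) rfl rfl rfl).lp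
    rw [h2]
    have h3 : R ^ 2 + 0 * y i0 + (-1) * ‖y‖ ^ 2 = R ^ 2 - ‖y‖ ^ 2 := by ring
    rw [h3]
    have := hFl (R ^ 2 - ‖y‖ ^ 2) (‖y‖ ^ 2) (by nlinarith [norm_nonneg y]) (by gcongr)
    linarith

lemma propagate {N : ℕ} (i0 : Fin N) {Ω : Set (Euc N)} (hΩ : IsOpen Ω) (h0 : (0 : Euc N) ∉ Ω)
    {c p : ℝ} (hc : 0 < c) {u : Euc N → ℝ}
    (hu0 : ∀ᵐ x ∂volume, x ∈ Ω → 0 ≤ u x)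
    (huloc : LocallyIntegrableOn u (Ω) volume)
    (hbu : LocallyIntegrableOn (fun x => c * ‖x‖ ^ (-2 : ℝ) * u x) (Ω) volume)
    (hsuper : ∀ φ : Euc N → ℝ, IsTestFun (Ω) φ → (∀ x, 0 ≤ φ x) →
      ∫ x in Ω, u x ^ p * φ x ≤
        ∫ x in Ω, u x * (-(lap φ x) - c * ‖x‖ ^ (-2 : ℝ) * φ x))
    (a : Euc N) {r R : ℝ} (hr : 0 < r) (hrR : r < R) (hR : closedBall a R ⊆ Ω)
    (hz : ∀ᵐ x ∂volume, x ∈ ball a r → u x = 0) :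
    ∀ᵐ x ∂volume, x ∈ ball a R → u x = 0 := by
  obtain ⟨φ, h1, h2, h3, h4, h5⟩ := exists_bump i0 a hr hrR
  have hφ : IsTestFun Ω φ :=
    ⟨h1, (isCompact_closedBall a R).of_isClosed_subset (isClosed_tsupport _) h4, h4.trans hR⟩
  have hs := hsuper φ hφ h2
  have hi1 := (integrable_u_lap huloc hφ).integrableOn (s := Ω)
  have hi2 := (integrable_u_test hbu hφ).integrableOn (s := Ω)
  have hu0' : ∀ᵐ x ∂volume.restrict Ω, 0 ≤ u x := by
    rwa [ae_restrict_iff' hΩ.measurableSet]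
  have hz' : ∀ᵐ x ∂volume.restrict Ω, x ∈ ball a r → u x = 0 := ae_restrict_of_ae hz
  have hpos : 0 ≤ ∫ x in Ω, u x ^ p * φ x := by
    apply integral_nonneg_of_ae
    filter_upwards [hu0'] with x hx
    exact mul_nonneg (Real.rpow_nonneg hx _) (h2 x)
  have hle : ∫ x in Ω, u x * (-(lap φ x) - c * ‖x‖ ^ (-2 : ℝ) * φ x) ≤
      ∫ x in Ω, -(c * ‖x‖ ^ (-2 : ℝ) * u x * φ x) := by
    apply integral_mono_ae
    · have := hi1.neg.sub hi2
      refine this.congr (Eventually.of_forall fun x => ?_)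
      simp only [Pi.sub_apply, Pi.neg_apply]
      ring
    · exact hi2.neg
    · filter_upwards [hu0', hz'] with x hx1 hx2
      by_cases hx : x ∈ ball a r
      · simp [hx2 hx]
      · have := mul_nonneg hx1 (h5 x hx)
        nlinarith
  rw [integral_neg] at hle
  have hnn : 0 ≤ᵐ[volume.restrict Ω] fun x => c * ‖x‖ ^ (-2 : ℝ) * u x * φ x := by
    filter_upwards [hu0'] with x hx
    have := h2 x
    simp only [Pi.zero_apply]
    positivity
  have heq : ∫ x in Ω, c * ‖x‖ ^ (-2 : ℝ) * u x * φ x = 0 :=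
    le_antisymm (by linarith) (integral_nonneg_of_ae hnn)
  rw [integral_eq_zero_iff_of_nonneg_ae hnn hi2] at heq
  rw [Filter.EventuallyEq, ae_restrict_iff' hΩ.measurableSet] at heq
  filter_upwards [heq] with x hx hxa
  have hxΩ := hR (ball_subset_closedBall hxa)
  have hx0 : x ≠ 0 := fun h => h0 (h ▸ hxΩ)
  have h6 := hx hxΩ
  simp only [Pi.zero_apply] at h6
  have h7 : 0 < ‖x‖ ^ (-2 : ℝ) := Real.rpow_pos_of_pos (norm_pos_iff.2 hx0) _
  have h8 := h3 x hxa
  simpa [hc.ne', h7.ne', h8.ne', hx0] using h6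

lemma zero_everywhere {N : ℕ} (i0 : Fin N) {Ω : Set (Euc N)} (hΩ : IsOpen Ω)
    (hcon : IsPreconnected Ω) (h0 : (0 : Euc N) ∉ Ω)
    {c p : ℝ} (hc : 0 < c) {u : Euc N → ℝ}
    (hu0 : ∀ᵐ x ∂volume, x ∈ Ω → 0 ≤ u x)
    (huloc : LocallyIntegrableOn u (Ω) volume)
    (hbu : LocallyIntegrableOn (fun x => c * ‖x‖ ^ (-2 : ℝ) * u x) (Ω) volume)
    (hsuper : ∀ φ : Euc N → ℝ, IsTestFun (Ω) φ → (∀ x, 0 ≤ φ x) →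
      ∫ x in Ω, u x ^ p * φ x ≤
        ∫ x in Ω, u x * (-(lap φ x) - c * ‖x‖ ^ (-2 : ℝ) * φ x))
    (a : Euc N) {r : ℝ} (hr : 0 < r) (ha : a ∈ Ω)
    (hz : ∀ᵐ x ∂volume, x ∈ ball a r → u x = 0) :
    ∀ᵐ x ∂volume, x ∈ Ω → u x = 0 := by
  set Z : Set (Euc N) := {x | ∃ r > 0, ∀ᵐ y ∂volume, y ∈ ball x r → u y = 0} with hZ
  have hZo : IsOpen Z := by
    rw [Metric.isOpen_iff]
    rintro x ⟨s, hs, hx⟩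
    refine ⟨s / 2, by linarith, fun y hy => ⟨s / 2, by linarith, ?_⟩⟩
    filter_upwards [hx] with w hw hwy
    apply hw
    rw [mem_ball] at *
    linarith [dist_triangle w y x]
  have hsub : Ω ⊆ Z := by
    apply hcon.subset_of_closure_inter_subset hZo ⟨a, ha, r, hr, hz⟩
    rintro x ⟨hx1, hx2⟩
    obtain ⟨ε, hε, hb⟩ := Metric.isOpen_iff.1 hΩ x hx2
    obtain ⟨z, ⟨s, hs, hzs⟩, hxz⟩ := Metric.mem_closure_iff.1 hx1 (ε / 4) (by linarith)
    have hp := propagate i0 hΩ h0 hc hu0 huloc hbu hsuper z (r := min s (ε / 4)) (R := ε / 2)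
      (by positivity) (lt_of_le_of_lt (min_le_right _ _) (by linarith))
      (fun y hy => hb (by
        rw [mem_closedBall] at hy
        rw [mem_ball]
        rw [dist_comm] at hxz
        linarith [dist_triangle y z x])) (by
        filter_upwards [hzs] with y hy hy2
        exact hy (ball_subset_ball (min_le_left _ _) hy2))
    refine ⟨ε / 4, by linarith, ?_⟩
    filter_upwards [hp] with y hy hy2
    apply hy
    rw [mem_ball] at *
    linarith [dist_triangle y x z]
  have hnull : volume (Ω ∩ {x | u x ≠ 0}) = 0 := by
    apply measure_null_of_locally_null
    rintro x ⟨hx, -⟩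
    obtain ⟨s, hs, hxs⟩ := hsub hx
    refine ⟨ball x s ∩ (Ω ∩ {x | u x ≠ 0}), ?_, ?_⟩
    · exact inter_mem (mem_nhdsWithin_of_mem_nhds (ball_mem_nhds x hs)) self_mem_nhdsWithin
    · rw [ae_iff] at hxs
      refine measure_mono_null ?_ hxs
      rintro y ⟨hy1, hy2, hy3⟩
      simp only [Set.mem_ofPred_eq, Classical.not_imp]
      exact ⟨hy1, hy3⟩
  rw [ae_iff]
  refine measure_mono_null ?_ hnull
  intro x hx
  simp only [Set.mem_ofPred_eq, Classical.not_imp] at hx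
  exact hx

/-! ### Geometry of the coordinates -/

lemma coord_sq_le {N : ℕ} (i0 : Fin N) (x : Euc N) : |x i0| ≤ ‖x‖ := by
  have := PiLp.norm_apply_le x i0
  rwa [Real.norm_eq_abs] at this

lemma DD_ge {N : ℕ} (i0 : Fin N) {K : ℝ} (hK : 0 < K) (x : Euc N) :
    (1 - K * ‖x‖) ^ 2 ≤ 1 - 2 * K * x i0 + K ^ 2 * ‖x‖ ^ 2 := by
  have := (abs_le.1 (coord_sq_le i0 x)).2
  nlinarith [mul_le_mul_of_nonneg_left this hK.le]

lemma SS_nonneg {N : ℕ} (i0 : Fin N) {K : ℝ} (hK : 0 < K) (x : Euc N) : 0 ≤ SS i0 K x := by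
  unfold SS
  have := DD_ge i0 hK x
  have h2 : 0 ≤ 1 - 2 * K * x i0 + K ^ 2 * ‖x‖ ^ 2 := le_trans (sq_nonneg _) this
  positivity

lemma TT_pos_SS {N : ℕ} {i0 : Fin N} {K : ℝ} (hK : 0 < K) {x : Euc N} (ht : 0 < TT i0 K x) :
    1 < SS i0 K x ∧ SS i0 K x = Real.exp (TT i0 K x) ^ 2 ∧ x ≠ 0 := by
  have h1 : 1 < SS i0 K x := by
    by_contra h
    have := Real.log_nonpos (SS_nonneg i0 hK x) (not_lt.1 h)
    unfold TT at ht
    linarith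
  refine ⟨h1, ?_, ?_⟩
  · rw [← Real.exp_nat_mul]
    unfold TT
    push_cast
    rw [mul_div_cancel₀ _ (by norm_num), Real.exp_log (by linarith)]
  · rintro rfl
    simp [SS] at h1
    linarith

lemma normsq_SS {N : ℕ} (i0 : Fin N) (K : ℝ) {x : Euc N} (hx : x ≠ 0) :
    ‖x‖ ^ 2 * SS i0 K x = 1 - 2 * K * x i0 + K ^ 2 * ‖x‖ ^ 2 := by
  have : ‖x‖ ≠ 0 := norm_ne_zero_iff.2 hx
  unfold SS
  field_simp

lemma norm_lower {N : ℕ} {i0 : Fin N} {K : ℝ} (hK : 0 < K) {x : Euc N} (ht : 0 < TT i0 K x) :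
    1 ≤ ‖x‖ * (Real.exp (TT i0 K x) + K) := by
  obtain ⟨h1, h2, hx⟩ := TT_pos_SS hK ht
  have h3 := normsq_SS i0 K hx
  have h4 := DD_ge i0 hK x
  rw [← h3, h2, ← mul_pow] at h4
  have := abs_le_of_sq_le_sq' h4 (by positivity)
  linarith [this.2]

lemma PP_pos_iff {N : ℕ} {i0 : Fin N} {K : ℝ} {x : Euc N} (hx : x ≠ 0) :
    0 < PP i0 K x ↔ K * ‖x‖ ^ 2 < x i0 := by
  have : 0 < ‖x‖ := norm_pos_iff.2 hx
  have h2 : 0 < (‖x‖ ^ 2) ^ (-(N : ℝ) / 2) := by positivity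
  unfold PP
  rw [mul_pos_iff_of_pos_left h2, sub_pos]

lemma norm_upper {N : ℕ} {i0 : Fin N} {K : ℝ} (hK : 0 < K) {x : Euc N} (hP : 0 < PP i0 K x)
    (ht : 0 < TT i0 K x) :
    ‖x‖ ≤ Real.exp (-TT i0 K x) ∧ ‖x‖ ^ 2 * SS i0 K x ≤ 1 ∧
      1 - 2 * K * Real.exp (-TT i0 K x) ≤ ‖x‖ ^ 2 * SS i0 K x := by
  obtain ⟨h1, h2, hx⟩ := TT_pos_SS hK ht
  have h3 := normsq_SS i0 K hx
  have h4 := (PP_pos_iff hx).1 hP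
  have h5 : ‖x‖ ^ 2 * SS i0 K x ≤ 1 := by
    rw [h3]
    nlinarith [sq_nonneg ‖x‖, mul_lt_mul_of_pos_left h4 hK, sq_nonneg (K * ‖x‖)]
  have h6 : ‖x‖ ≤ Real.exp (-TT i0 K x) := by
    rw [h2, ← mul_pow] at h5
    have h7 : ‖x‖ * Real.exp (TT i0 K x) ≤ 1 := by
      have := (sq_le_one_iff_abs_le_one _).1 h5
      exact (le_abs_self _).trans this
    rw [Real.exp_neg, ← one_div, le_div_iff₀ (Real.exp_pos _)]
    exact h7
  refine ⟨h6, h5, ?_⟩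
  rw [h3]
  have h8 := (abs_le.1 (coord_sq_le i0 x)).2
  have h9 : x i0 ≤ Real.exp (-TT i0 K x) := h8.trans h6
  nlinarith [sq_nonneg (K * ‖x‖), mul_le_mul_of_nonneg_left h9 hK.le]

/-! ### The functions `P · Q(T)` -/

lemma ww_evzero {N : ℕ} {i0 : Fin N} {K : ℝ} (hK : 0 < K) {Q : ℝ → ℝ} {t1 : ℝ}
    (hQ0 : ∀ t ≤ 0, Q t = 0) (hQ1 : ∀ t, t1 ≤ t → Q t = 0) {x : Euc N}
    (hx : x = 0 ∨ SS i0 K x < 1) :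
    ∀ᶠ y in 𝓝 x, PP i0 K y * Q (TT i0 K y) = 0 := by
  by_cases hx0 : x = 0
  · subst hx0
    have : ball (0 : Euc N) (1 / (Real.exp t1 + K)) ∈ 𝓝 0 := ball_mem_nhds _ (by positivity)
    filter_upwards [this] with y hy
    by_contra hne
    have hQ : Q (TT i0 K y) ≠ 0 := fun h => hne (by rw [h, mul_zero])
    have ht : 0 < TT i0 K y := by
      by_contra h; exact hQ (hQ0 _ (not_lt.1 h))
    have ht1 : TT i0 K y < t1 := by
      by_contra h; exact hQ (hQ1 _ (not_lt.1 h))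
    have h1 := norm_lower hK ht
    rw [mem_ball_zero_iff, lt_div_iff₀ (by positivity)] at hy
    have : Real.exp (TT i0 K y) ≤ Real.exp t1 := Real.exp_le_exp.2 ht1.le
    have : ‖y‖ * (Real.exp (TT i0 K y) + K) ≤ ‖y‖ * (Real.exp t1 + K) := by gcongr
    linarith
  · have hs := hx.resolve_left hx0
    have hc : ContinuousAt (SS i0 K) x := (jet_S i0 K hx0).cd.continuousAt
    filter_upwards [hc.eventually (gt_mem_nhds hs)] with y hy
    have : TT i0 K y ≤ 0 := by
      have := Real.log_nonpos (SS_nonneg i0 hK y) hy.le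
      unfold TT; linarith
    rw [hQ0 _ this, mul_zero]

lemma PP_smooth {N : ℕ} (i0 : Fin N) (K : ℝ) {x : Euc N} (hx : x ≠ 0) :
    ContDiffAt ℝ (⊤ : ℕ∞) (PP i0 K) x := by
  have h1 : ContDiffAt ℝ (⊤ : ℕ∞) (fun y : Euc N => ‖y‖ ^ 2) x := contDiffAt_id.norm_sq ℝ
  have h2 : ContDiffAt ℝ (⊤ : ℕ∞) (fun y : Euc N => y i0) x :=
    (EuclideanSpace.proj (𝕜 := ℝ) i0).contDiff.contDiffAt
  have h3 : ‖x‖ ^ 2 ≠ 0 := by simpa using hx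
  exact (h1.rpow_const_of_ne h3).mul (h2.sub (contDiffAt_const.mul h1))

lemma TT_smooth {N : ℕ} (i0 : Fin N) (K : ℝ) {x : Euc N} (hx : x ≠ 0) (hs : 0 < SS i0 K x) :
    ContDiffAt ℝ (⊤ : ℕ∞) (TT i0 K) x := by
  have h1 : ContDiffAt ℝ (⊤ : ℕ∞) (fun y : Euc N => ‖y‖ ^ 2) x := contDiffAt_id.norm_sq ℝ
  have h2 : ContDiffAt ℝ (⊤ : ℕ∞) (fun y : Euc N => y i0) x :=
    (EuclideanSpace.proj (𝕜 := ℝ) i0).contDiff.contDiffAt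
  have h3 : ‖x‖ ^ 2 ≠ 0 := by simpa using hx
  have h4 : ContDiffAt ℝ (⊤ : ℕ∞) (SS i0 K) x :=
    (h1.inv h3).mul ((contDiffAt_const.sub (contDiffAt_const.mul h2)).add (contDiffAt_const.mul h1))
  exact (h4.log hs.ne').div_const 2

lemma ww_smooth {N : ℕ} {i0 : Fin N} {K : ℝ} (hK : 0 < K) {Q : ℝ → ℝ} {t1 : ℝ}
    (hQ : ContDiff ℝ (⊤ : ℕ∞) Q)
    (hQ0 : ∀ t ≤ 0, Q t = 0) (hQ1 : ∀ t, t1 ≤ t → Q t = 0) :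
    ContDiff ℝ (⊤ : ℕ∞) (fun y => PP i0 K y * Q (TT i0 K y)) := by
  rw [contDiff_iff_contDiffAt]
  intro x
  by_cases hx : x = 0 ∨ SS i0 K x < 1
  · have := ww_evzero hK hQ0 hQ1 hx
    exact (contDiffAt_const (c := (0 : ℝ))).congr_of_eventuallyEq this
  · push Not at hx
    have hs : 0 < SS i0 K x := by linarith [hx.2]
    exact (PP_smooth i0 K hx.1).mul (hQ.contDiffAt.comp x (TT_smooth i0 K hx.1 hs))

/-- The region carrying the test function. -/
def region {N : ℕ} (i0 : Fin N) (K t0 t1 : ℝ) : Set (Euc N) :=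
  {x | 0 < PP i0 K x ∧ t0 < TT i0 K x ∧ TT i0 K x < t1}

/-- A compact set containing the region. -/
def creg {N : ℕ} (i0 : Fin N) (K ρ t1 : ℝ) : Set (Euc N) :=
  {x | K * ‖x‖ ^ 2 ≤ x i0 ∧ 1 / (Real.exp t1 + K) ≤ ‖x‖ ∧ ‖x‖ ≤ ρ}

lemma creg_compact {N : ℕ} (i0 : Fin N) (K ρ t1 : ℝ) : IsCompact (creg i0 K ρ t1) := by
  apply (isCompact_closedBall (0 : Euc N) ρ).of_isClosed_subset
  · have hc : Continuous fun x : Euc N => x i0 := by fun_prop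
    have c1 : IsClosed {x : Euc N | K * ‖x‖ ^ 2 ≤ x i0} := isClosed_le (by fun_prop) hc
    have c2 : IsClosed {x : Euc N | 1 / (Real.exp t1 + K) ≤ ‖x‖} :=
      isClosed_le (by fun_prop) (by fun_prop)
    have c3 : IsClosed {x : Euc N | ‖x‖ ≤ ρ} := isClosed_le (by fun_prop) (by fun_prop)
    exact c1.inter (c2.inter c3)
  · intro x hx
    simpa using hx.2.2

lemma region_subset {N : ℕ} {i0 : Fin N} {K ρ t0 t1 : ℝ} (hK : 0 < K) (ht0 : 0 ≤ t0)
    (hρ : Real.exp (-t0) ≤ ρ) : region i0 K t0 t1 ⊆ creg i0 K ρ t1 := by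
  rintro x ⟨h1, h2, h3⟩
  have ht : 0 < TT i0 K x := by linarith
  obtain ⟨-, -, hx⟩ := TT_pos_SS hK ht
  refine ⟨((PP_pos_iff hx).1 h1).le, ?_, ?_⟩
  · have h4 := norm_lower hK ht
    rw [div_le_iff₀ (by positivity)]
    have : Real.exp (TT i0 K x) ≤ Real.exp t1 := Real.exp_le_exp.2 h3.le
    have : ‖x‖ * (Real.exp (TT i0 K x) + K) ≤ ‖x‖ * (Real.exp t1 + K) := by gcongr
    linarith
  · refine (norm_upper hK h1 ht).1.trans (le_trans ?_ hρ)
    exact Real.exp_le_exp.2 (by linarith)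

lemma creg_ne_zero {N : ℕ} {i0 : Fin N} {K ρ t1 : ℝ} (hK : 0 < K) {x : Euc N}
    (hx : x ∈ creg i0 K ρ t1) : x ≠ 0 := by
  rintro rfl
  have h1 := hx.2.1
  rw [norm_zero] at h1
  have : 0 < 1 / (Real.exp t1 + K) := by positivity
  linarith

lemma ww_region {N : ℕ} {i0 : Fin N} {K t0 t1 : ℝ} {Q : ℝ → ℝ} (hQn : ∀ t, 0 ≤ Q t)
    (hQ0 : ∀ t ≤ t0, Q t = 0) (hQ1 : ∀ t, t1 ≤ t → Q t = 0) {x : Euc N}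
    (hx : 0 < PP i0 K x * Q (TT i0 K x)) : x ∈ region i0 K t0 t1 := by
  have h1 := hQn (TT i0 K x)
  have hQ : Q (TT i0 K x) ≠ 0 := fun h => by rw [h, mul_zero] at hx; exact lt_irrefl _ hx
  refine ⟨?_, ?_, ?_⟩
  · exact pos_of_mul_pos_left hx h1
  · by_contra h; exact hQ (hQ0 _ (not_lt.1 h))
  · by_contra h; exact hQ (hQ1 _ (not_lt.1 h))

lemma test_isTest {N : ℕ} {i0 : Fin N} {K ρ t0 t1 δ : ℝ} (hK : 0 < K) (ht0 : 0 ≤ t0)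
    (hρ : Real.exp (-t0) ≤ ρ) (hδ : 0 < δ) {Ω : Set (Euc N)}
    (hΩ : ∀ y : Euc N, y ≠ 0 → ‖y‖ ≤ ρ → K * ‖y‖ ^ 2 ≤ y i0 → y ∈ Ω) {Q : ℝ → ℝ}
    (hQ : ContDiff ℝ (⊤ : ℕ∞) Q) (hQn : ∀ t, 0 ≤ Q t)
    (hQ0 : ∀ t ≤ t0, Q t = 0) (hQ1 : ∀ t, t1 ≤ t → Q t = 0) :
    IsTestFun Ω (fun y => hh δ (PP i0 K y * Q (TT i0 K y))) ∧ creg i0 K ρ t1 ⊆ Ω := by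
  have hsub : creg i0 K ρ t1 ⊆ Ω := fun y hy => hΩ y (creg_ne_zero hK hy) hy.2.2 hy.1
  have hts : tsupport (fun y => hh δ (PP i0 K y * Q (TT i0 K y))) ⊆ creg i0 K ρ t1 := by
    apply closure_minimal _ (creg_compact i0 K ρ t1).isClosed
    intro y hy
    apply region_subset hK ht0 hρ
    apply ww_region hQn hQ0 hQ1
    by_contra h
    exact hy (hh_nonpos hδ (not_lt.1 h))
  exact ⟨⟨(hh_smooth δ).comp (ww_smooth hK hQ (fun t ht => hQ0 t (ht.trans ht0)) hQ1),
    (creg_compact i0 K ρ t1).of_isClosed_subset (isClosed_tsupport _) hts, hts.trans hsub⟩, hsub⟩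

/-- Pointwise lower bound for the Laplacian of the truncated test function. -/
lemma test_lap {N : ℕ} {i0 : Fin N} {K t0 t1 δ : ℝ} (hK : 0 < K) (ht0 : 0 ≤ t0)
    (hδ : 0 < δ) {Q : ℝ → ℝ}
    (hQ : ContDiff ℝ (⊤ : ℕ∞) Q)
    (hQ0 : ∀ t ≤ t0, Q t = 0) (hQ1 : ∀ t, t1 ≤ t → Q t = 0) (x : Euc N) :
    deriv (hh δ) (PP i0 K x * Q (TT i0 K x)) * (((‖x‖ ^ 2) ^ 2 * SS i0 K x)⁻¹ * PP i0 K x *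
        (deriv (deriv Q) (TT i0 K x) + N * deriv Q (TT i0 K x))) ≤
    lap (fun y => hh δ (PP i0 K y * Q (TT i0 K y))) x := by
  by_cases hx : x = 0 ∨ SS i0 K x < 1
  · have h := ww_evzero hK (fun t ht => hQ0 t (ht.trans ht0)) hQ1 hx
    have h1 : x ∉ tsupport (fun y => hh δ (PP i0 K y * Q (TT i0 K y))) := by
      rw [notMem_tsupport_iff_eventuallyEq]
      filter_upwards [h] with y hy
      rw [hy, hh_nonpos hδ le_rfl]; rfl
    rw [lap_zero_off h1, h.self_of_nhds, hh_deriv_nonpos hδ le_rfl, zero_mul]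
  · push Not at hx
    have hs : 0 < SS i0 K x := by linarith [hx.2]
    obtain ⟨α, β, hj⟩ := jet_W i0 K hx.1 hs (hQ.of_le two_le_smooth)
    have h := hj.comp (F := hh δ) (Fd := deriv (hh δ))
      (Fdd := deriv (deriv (hh δ)) (PP i0 K x * Q (TT i0 K x)))
      ((hh_smooth δ).of_le two_le_smooth).contDiffAt
      (Eventually.of_forall fun z => (hh_diff δ z).hasDerivAt)
      (hh_deriv_diff δ _).hasDerivAt
    rw [h.lp]
    have h1 := mul_nonneg (hh_deriv2_nonneg hδ (PP i0 K x * Q (TT i0 K x))) (quad_nonneg i0 x α β)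
    linarith

/-! ### The specific test function -/

def QQ (b T : ℝ) (n : ℕ) (k ζ : ℝ → ℝ) (t : ℝ) : ℝ :=
  Real.exp (b * t) * (k t * ζ (t / T) ^ (n + 2))

lemma exp_ode {G : ℝ → ℝ} (hG : ContDiff ℝ (⊤ : ℕ∞) G) (ν N c t : ℝ) (hc : c = N ^ 2 / 4 - ν ^ 2) :
    deriv (deriv fun s => Real.exp ((ν - N / 2) * s) * G s) t
      + N * deriv (fun s => Real.exp ((ν - N / 2) * s) * G s) t =
    Real.exp ((ν - N / 2) * t) * (deriv (deriv G) t + 2 * ν * deriv G t - c * G t) := by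
  set b := ν - N / 2 with hb
  have hE : ∀ s, HasDerivAt (fun s => Real.exp (b * s)) (b * Real.exp (b * s)) s := fun s => by
    have h1 : HasDerivAt (fun y : ℝ => b * y) b s := by simpa using (hasDerivAt_id s).const_mul b
    exact h1.exp.congr_deriv (by ring)
  have hG1 : ∀ s, HasDerivAt G (deriv G s) s := fun s => (smooth_diff hG s).hasDerivAt
  have hG2 : ∀ s, HasDerivAt (deriv G) (deriv (deriv G) s) s :=
    fun s => (smooth_diff (contDiff_deriv2 hG) s).hasDerivAt
  have h1 : ∀ s, deriv (fun s => Real.exp (b * s) * G s) s =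
      b * Real.exp (b * s) * G s + Real.exp (b * s) * deriv G s :=
    fun s => ((hE s).fun_mul (hG1 s)).deriv
  have h2 : deriv (deriv fun s => Real.exp (b * s) * G s) t =
      (b * (b * Real.exp (b * t)) * G t + b * Real.exp (b * t) * deriv G t) +
      (b * Real.exp (b * t) * deriv G t + Real.exp (b * t) * deriv (deriv G) t) := by
    rw [funext h1]
    exact ((((hE t).const_mul b).fun_mul (hG1 t)).fun_add ((hE t).fun_mul (hG2 t))).deriv
  rw [h2, h1, hc, hb]
  ring

lemma scalar_young {u a z p q : ℝ} {n : ℕ} (hpq : p.HolderConjugate q) (hu : 0 ≤ u) (ha : 0 ≤ a)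
    (hz : 0 ≤ z) (hz1 : z ≤ 1) (hn : (n + 2 : ℝ) / p ≤ n) :
    u * (a * z ^ n) ≤ u ^ p * z ^ (n + 2) / p + a ^ q / q := by
  have hp := hpq.pos
  have hq := hpq.symm.pos
  have h1 := Real.young_inequality_of_nonneg (a := u * z ^ ((n + 2 : ℝ) / p))
    (b := a * z ^ ((n : ℝ) - (n + 2 : ℝ) / p)) (by positivity) (by positivity) hpq
  have h2 : z ^ ((n + 2 : ℝ) / p) * z ^ ((n : ℝ) - (n + 2 : ℝ) / p) = z ^ n := by
    rw [← Real.rpow_add_of_nonneg hz (by positivity) (by linarith), add_sub_cancel, Real.rpow_natCast]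
  have h3 : (u * z ^ ((n + 2 : ℝ) / p)) ^ p = u ^ p * z ^ (n + 2) := by
    rw [Real.mul_rpow hu (by positivity), ← Real.rpow_mul hz, div_mul_cancel₀ _ hp.ne']
    congr 1
    exact_mod_cast Real.rpow_natCast z (n + 2)
  have h4 : (a * z ^ ((n : ℝ) - (n + 2 : ℝ) / p)) ^ q ≤ a ^ q := by
    apply Real.rpow_le_rpow (by positivity) _ hq.le
    have : z ^ ((n : ℝ) - (n + 2 : ℝ) / p) ≤ 1 := Real.rpow_le_one hz hz1 (by linarith)
    nlinarith
  rw [h3] at h1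
  calc u * (a * z ^ n) = u * z ^ ((n + 2 : ℝ) / p) * (a * z ^ ((n : ℝ) - (n + 2 : ℝ) / p)) := by
        rw [← h2]; ring
    _ ≤ _ := h1
    _ ≤ _ := by gcongr

lemma QQ_smooth {b T : ℝ} {n : ℕ} {k ζ : ℝ → ℝ} (hk : ContDiff ℝ (⊤ : ℕ∞) k)
    (hζ : ContDiff ℝ (⊤ : ℕ∞) ζ) : ContDiff ℝ (⊤ : ℕ∞) (QQ b T n k ζ) := by
  have h1 : ContDiff ℝ (⊤ : ℕ∞) (fun t => ζ (t / T)) := hζ.comp (contDiff_id.div_const T)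
  exact (Real.contDiff_exp.comp (contDiff_const.mul contDiff_id)).mul (hk.mul (h1.pow _))

/-- Pointwise estimate on the region. -/
lemma test_est {N : ℕ} {i0 : Fin N} {K : ℝ} (hK : 0 < K)
    {ν c t0 : ℝ} {θ : ℕ} {M T0 : ℝ} {k : ℝ → ℝ} (hθ : θ ≤ 1) (hν : 0 ≤ ν)
    (hc : c = (N : ℝ) ^ 2 / 4 - ν ^ 2) (hc0 : 0 < c) (ht0 : 0 ≤ t0)
    (hM : 0 < M) (hT0 : 1 ≤ T0) (hk : IsProfile ν (2 * K * c) t0 θ M T0 k) (n : ℕ) {ζ : ℝ → ℝ}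
    {A : ℝ} (hA : 0 < A) (hsm : ContDiff ℝ (⊤ : ℕ∞) ζ) (h01 : ∀ s, 0 ≤ ζ s ∧ ζ s ≤ 1)
    (hζ2' : ∀ s, 2 ≤ s → ζ s = 0)
    (hζ1 : ∀ s, |deriv (fun s => ζ s ^ (n + 2)) s| ≤ A * ζ s ^ n)
    (hζ2 : ∀ s, |deriv (deriv (fun s => ζ s ^ (n + 2))) s| ≤ A * ζ s ^ n)
    (hl1 : ∀ s ≤ 1, deriv (fun s => ζ s ^ (n + 2)) s = 0)
    (hl2 : ∀ s ≤ 1, deriv (deriv (fun s => ζ s ^ (n + 2))) s = 0)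
    {T δ : ℝ} (hT : T0 ≤ T) (hδ : 0 < δ) {x : Euc N} (hx : x ∈ region i0 K t0 (2 * T)) :
    -(lap (fun y => hh δ (PP i0 K y * QQ (ν - N / 2) T n k ζ (TT i0 K y))) x)
      - c * ‖x‖ ^ (-2 : ℝ) * hh δ (PP i0 K x * QQ (ν - N / 2) T n k ζ (TT i0 K x)) ≤
    (if T ≤ TT i0 K x then PP i0 K x * Real.exp ((ν - N / 2) * TT i0 K x) * k (TT i0 K x) *
      ((((‖x‖ ^ 2) ^ 2 * SS i0 K x)⁻¹ * (A * (4 * M + 1) / T ^ (1 + θ))) *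
        ζ (TT i0 K x / T) ^ n) else 0) + δ * (c * ‖x‖ ^ (-2 : ℝ)) := by
  have hk' := hk
  obtain ⟨hks, hk0, hkpos, -, -⟩ := hk
  have hTpos : 0 < T := by linarith
  obtain ⟨hP, htx0, htx1⟩ := hx
  have ht : 0 < TT i0 K x := by linarith
  obtain ⟨hS1, hS2, hx0⟩ := TT_pos_SS hK ht
  obtain ⟨hn1, hn2, hn3⟩ := norm_upper hK hP ht
  have hQs : ContDiff ℝ (⊤ : ℕ∞) (QQ (ν - N / 2) T n k ζ) := QQ_smooth hks hsm
  have hQ0 : ∀ t ≤ t0, QQ (ν - N / 2) T n k ζ t = 0 := fun t ht => by simp [QQ, hk0 t ht]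
  have hQ1 : ∀ t, 2 * T ≤ t → QQ (ν - N / 2) T n k ζ t = 0 := fun t ht => by
    have : 2 ≤ t / T := by rw [le_div_iff₀ hTpos]; exact ht
    simp [QQ, hζ2' _ this]
  have hlap := test_lap (i0 := i0) hK ht0 hδ hQs hQ0 hQ1 x
  have hG : ContDiff ℝ (⊤ : ℕ∞) (fun s => k s * ζ (s / T) ^ (n + 2)) := by
    have h1 : ContDiff ℝ (⊤ : ℕ∞) (fun t => ζ (t / T)) := hsm.comp (contDiff_id.div_const T)
    exact hks.mul (h1.pow _)
  have hode := exp_ode hG ν N c (TT i0 K x) hc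
  have hcut := cutoff_profile hθ hν hM hT0 hk' n hA hsm h01 hζ1 hζ2 hl1 hl2 hT htx0
  have hQdef : QQ (ν - N / 2) T n k ζ = fun s => Real.exp ((ν - N / 2) * s) * (k s * ζ (s / T) ^ (n + 2)) := rfl
  rw [hQdef, hode] at hlap
  rw [hQdef]
  dsimp only at hlap ⊢
  have hxn : 0 < ‖x‖ := norm_pos_iff.2 hx0
  have hr : ‖x‖ ^ (-2 : ℝ) = ((‖x‖ ^ 2) ^ 2 * SS i0 K x)⁻¹ * (‖x‖ ^ 2 * SS i0 K x) := by
    rw [Real.rpow_neg hxn.le]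
    have : SS i0 K x ≠ 0 := by linarith
    have h2 : ‖x‖ ^ (2 : ℝ) = ‖x‖ ^ 2 := by exact_mod_cast Real.rpow_natCast ‖x‖ 2
    rw [h2]
    field_simp
  have hrp : 0 < ‖x‖ ^ (-2 : ℝ) := by positivity
  have hz := (h01 (TT i0 K x / T)).1
  have hkp := hkpos _ htx0
  generalize lap (fun y => hh δ (PP i0 K y * (Real.exp ((ν - N / 2) * TT i0 K y) *
    (k (TT i0 K y) * ζ (TT i0 K y / T) ^ (n + 2))))) x = Lp at *
  have hDpos : 0 < ((‖x‖ ^ 2) ^ 2 * SS i0 K x)⁻¹ := by positivity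
  generalize ((‖x‖ ^ 2) ^ 2 * SS i0 K x)⁻¹ = D at *
  have he := Real.exp_pos ((ν - N / 2) * TT i0 K x)
  generalize Real.exp ((ν - N / 2) * TT i0 K x) = e at *
  generalize deriv (deriv fun s => k s * ζ (s / T) ^ (n + 2)) (TT i0 K x)
      + 2 * ν * deriv (fun s => k s * ζ (s / T) ^ (n + 2)) (TT i0 K x) = V at *
  set G := k (TT i0 K x) * ζ (TT i0 K x / T) ^ (n + 2) with hGdef
  have hG0 : 0 ≤ G := by positivity
  set w := PP i0 K x * (e * G) with hw
  have hw0 : 0 ≤ w := by positivity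
  set err := (if T ≤ TT i0 K x then A * (4 * M + 1) / T ^ (1 + θ) *
    (k (TT i0 K x) * ζ (TT i0 K x / T) ^ n) else 0) with herr
  have herr0 : 0 ≤ err := by rw [herr]; split_ifs <;> positivity
  have hE : (if T ≤ TT i0 K x then PP i0 K x * e * k (TT i0 K x) *
      (D * (A * (4 * M + 1) / T ^ (1 + θ)) * ζ (TT i0 K x / T) ^ n) else 0) =
      D * PP i0 K x * e * err := by
    rw [herr]; split_ifs <;> ring
  rw [hE]
  have h1 : -(D * PP i0 K x * e * err) - c * ‖x‖ ^ (-2 : ℝ) * w ≤ D * PP i0 K x * (e * (V - c * G)) := by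
    have h2 : c * ‖x‖ ^ (-2 : ℝ) * w ≥ D * PP i0 K x * e * (c * (1 - 2 * K * Real.exp (-TT i0 K x)) * G) := by
      rw [hr, hw]
      have : D * PP i0 K x * e * (c * (1 - 2 * K * Real.exp (-TT i0 K x)) * G) ≤
        D * PP i0 K x * e * (c * (‖x‖ ^ 2 * SS i0 K x) * G) := by gcongr
      linarith
    have h3 := mul_le_mul_of_nonneg_left hcut (by positivity : 0 ≤ D * PP i0 K x * e)
    linarith
  have hd0 := hh_deriv_nonneg hδ w
  have hd1 := hh_deriv_le_one hδ w
  have hd2 : deriv (hh δ) w * w - hh δ w ≤ δ := by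
    rcases hw0.eq_or_lt with h | h
    · rw [← h, hh_nonpos hδ le_rfl]; linarith
    · exact hh_euler_le hδ h
  have h4 := mul_le_mul_of_nonneg_left h1 hd0
  have h5 : deriv (hh δ) w * (D * PP i0 K x * e * err) ≤ D * PP i0 K x * e * err :=
    mul_le_of_le_one_left (by positivity) hd1
  have h6 := mul_le_mul_of_nonneg_left hd2 (by positivity : 0 ≤ c * ‖x‖ ^ (-2 : ℝ))
  linarith

lemma test_off {N : ℕ} {i0 : Fin N} {K t0 t1 δ : ℝ} (hK : 0 < K) (ht0 : 0 ≤ t0)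
    (hδ : 0 < δ) {Q : ℝ → ℝ}
    (hQ : ContDiff ℝ (⊤ : ℕ∞) Q) (hQn : ∀ t, 0 ≤ Q t)
    (hQ0 : ∀ t ≤ t0, Q t = 0) (hQ1 : ∀ t, t1 ≤ t → Q t = 0) {x : Euc N}
    (hx : x ∉ region i0 K t0 t1) :
    hh δ (PP i0 K x * Q (TT i0 K x)) = 0 ∧
      0 ≤ lap (fun y => hh δ (PP i0 K y * Q (TT i0 K y))) x := by
  have hw : PP i0 K x * Q (TT i0 K x) ≤ 0 := by
    by_contra h
    exact hx (ww_region hQn hQ0 hQ1 (not_le.1 h))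
  have := test_lap (i0 := i0) hK ht0 hδ hQ hQ0 hQ1 x
  rw [hh_deriv_nonpos hδ hw, zero_mul] at this
  exact ⟨hh_nonpos hδ hw, this⟩

/-- The power bound. -/
lemma power_bound {N : ℕ} {i0 : Fin N} {K : ℝ} (hK : 0 < K)
    {ν t0 : ℝ} {θ : ℕ} {M T0 : ℝ} {k : ℝ → ℝ} (hKt : K ≤ Real.exp t0)
    (hb : 0 ≤ (N : ℝ) / 2 - ν) (ht0 : 0 ≤ t0)
    (hM : 0 < M) (hT0 : 1 ≤ T0) {C : ℝ} (hk : IsProfile ν C t0 θ M T0 k)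
    {A q : ℝ} (hA : 0 < A) (hq : 0 < q) (hq2 : 2 * q ≤ (N : ℝ) / 2 - ν + 1)
    {T : ℝ} (hT : T0 ≤ T) {x : Euc N} (hx : x ∈ region i0 K t0 (2 * T)) (hTx : T ≤ TT i0 K x) :
    PP i0 K x * Real.exp ((ν - N / 2) * TT i0 K x) * k (TT i0 K x) *
      (((‖x‖ ^ 2) ^ 2 * SS i0 K x)⁻¹ * (A * (4 * M + 1) / T ^ (1 + θ))) ^ q ≤
    ((2 : ℝ) ^ ((N : ℝ) / 2 - ν) * (M * 2 ^ θ) * (4 * (A * (4 * M + 1))) ^ q) *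
      (T ^ θ * ((T ^ (1 + θ)) ^ q)⁻¹) * (‖x‖ ^ N)⁻¹ ∧
    Real.exp (-(2 * T)) / 2 ≤ ‖x‖ ∧ ‖x‖ ≤ Real.exp (-T) := by
  obtain ⟨hks, hk0, hkpos, -, hkT⟩ := hk
  have hTpos : 0 < T := by linarith
  obtain ⟨hP, htx0, htx1⟩ := hx
  have ht : 0 < TT i0 K x := by linarith
  obtain ⟨hS1, hS2, hx0⟩ := TT_pos_SS hK ht
  obtain ⟨hn1, hn2, hn3⟩ := norm_upper hK hP ht
  have hxn : 0 < ‖x‖ := norm_pos_iff.2 hx0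
  have hlow := norm_lower hK ht
  set t := TT i0 K x with htdef
  have hKe : K ≤ Real.exp t := hKt.trans (Real.exp_le_exp.2 htx0.le)
  have hlow2 : 1 ≤ ‖x‖ * (2 * Real.exp t) := hlow.trans (by gcongr; linarith)
  have het : Real.exp (-t) ≤ 2 * ‖x‖ := by
    rw [Real.exp_neg, ← one_div, div_le_iff₀ (Real.exp_pos _)]
    linarith
  have hx1 : ‖x‖ ≤ 1 := hn1.trans (Real.exp_le_one_iff.2 (by linarith))
  refine ⟨?_, ?_, hn1.trans (Real.exp_le_exp.2 (by linarith))⟩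
  swap
  · have : Real.exp (-(2 * T)) ≤ Real.exp (-t) := Real.exp_le_exp.2 (by linarith)
    linarith
  have h1 : PP i0 K x ≤ (‖x‖ ^ N)⁻¹ * ‖x‖ := by
    unfold PP
    have h2 : (‖x‖ ^ 2) ^ (-(N : ℝ) / 2) = (‖x‖ ^ N)⁻¹ := by
      have : ‖x‖ ^ 2 = ‖x‖ ^ (2 : ℝ) := by exact_mod_cast (Real.rpow_natCast ‖x‖ 2).symm
      rw [this, ← Real.rpow_mul hxn.le, ← Real.rpow_natCast, ← Real.rpow_neg hxn.le]
      congr 1; ring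
    rw [h2]
    gcongr
    have := (abs_le.1 (coord_sq_le i0 x)).2
    nlinarith [sq_nonneg ‖x‖]
  have h2 : Real.exp ((ν - N / 2) * t) ≤ 2 ^ ((N : ℝ) / 2 - ν) * ‖x‖ ^ ((N : ℝ) / 2 - ν) := by
    have : Real.exp ((ν - N / 2) * t) = (Real.exp (-t)) ^ ((N : ℝ) / 2 - ν) := by
      rw [← Real.exp_mul]; congr 1; ring
    rw [this, ← Real.mul_rpow (by norm_num) hxn.le]
    exact Real.rpow_le_rpow (Real.exp_pos _).le het hb
  have h3 : k t ≤ M * 2 ^ θ * T ^ θ := by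
    refine (hkT t (hT.trans hTx)).2.1.trans ?_
    rw [mul_assoc, ← mul_pow]
    gcongr
  have h4 : ((‖x‖ ^ 2) ^ 2 * SS i0 K x)⁻¹ ≤ 4 * (‖x‖ ^ 2)⁻¹ := by
    rw [hS2]
    have : 1 ≤ 4 * (‖x‖ ^ 2 * Real.exp t ^ 2) := by nlinarith
    rw [inv_eq_one_div, div_le_iff₀ (by positivity)]
    calc (1:ℝ) ≤ _ := this
      _ = _ := by field_simp
  have h5 : (((‖x‖ ^ 2) ^ 2 * SS i0 K x)⁻¹ * (A * (4 * M + 1) / T ^ (1 + θ))) ^ q ≤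
      (4 * (A * (4 * M + 1))) ^ q * ((T ^ (1 + θ)) ^ q)⁻¹ * ‖x‖ ^ (-(2 * q)) := by
    have h6 : ‖x‖ ^ (-(2 * q)) = ((‖x‖ ^ 2)⁻¹) ^ q := by
      have : ‖x‖ ^ 2 = ‖x‖ ^ (2 : ℝ) := by exact_mod_cast (Real.rpow_natCast ‖x‖ 2).symm
      rw [this, ← Real.rpow_neg hxn.le, ← Real.rpow_mul hxn.le]
      congr 1; ring
    rw [h6, ← Real.inv_rpow (by positivity), ← Real.mul_rpow (by positivity) (by positivity),
      ← Real.mul_rpow (by positivity) (by positivity)]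
    apply Real.rpow_le_rpow (by positivity) _ hq.le
    calc _ ≤ 4 * (‖x‖ ^ 2)⁻¹ * (A * (4 * M + 1) / T ^ (1 + θ)) := by gcongr
      _ = _ := by ring
  have hkp := (hkpos _ htx0).le
  calc _ ≤ ((‖x‖ ^ N)⁻¹ * ‖x‖) * (2 ^ ((N : ℝ) / 2 - ν) * ‖x‖ ^ ((N : ℝ) / 2 - ν)) *
        (M * 2 ^ θ * T ^ θ) *
        ((4 * (A * (4 * M + 1))) ^ q * ((T ^ (1 + θ)) ^ q)⁻¹ * ‖x‖ ^ (-(2 * q))) := by gcongr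
    _ = ((2 : ℝ) ^ ((N : ℝ) / 2 - ν) * (M * 2 ^ θ) * (4 * (A * (4 * M + 1))) ^ q) *
      (T ^ θ * ((T ^ (1 + θ)) ^ q)⁻¹) * (‖x‖ ^ N)⁻¹ *
        (‖x‖ ^ (1 : ℝ) * ‖x‖ ^ ((N : ℝ) / 2 - ν) * ‖x‖ ^ (-(2 * q))) := by
        rw [Real.rpow_one]; ring
    _ ≤ ((2 : ℝ) ^ ((N : ℝ) / 2 - ν) * (M * 2 ^ θ) * (4 * (A * (4 * M + 1))) ^ q) *
      (T ^ θ * ((T ^ (1 + θ)) ^ q)⁻¹) * (‖x‖ ^ N)⁻¹ * 1 := by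
        gcongr
        rw [← Real.rpow_add hxn, ← Real.rpow_add hxn]
        exact Real.rpow_le_one hxn.le hx1 (by linarith)
    _ = _ := by ring

/-! ### The annulus -/

def annulus (N : ℕ) (a b : ℝ) : Set (Euc N) := {x | a ≤ ‖x‖ ∧ ‖x‖ ≤ b}

lemma annulus_compact (N : ℕ) (a b : ℝ) : IsCompact (annulus N a b) := by
  apply (isCompact_closedBall (0 : Euc N) b).of_isClosed_subset
  · have c2 : IsClosed {x : Euc N | a ≤ ‖x‖} := isClosed_le (by fun_prop) (by fun_prop)
    have c3 : IsClosed {x : Euc N | ‖x‖ ≤ b} := isClosed_le (by fun_prop) (by fun_prop)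
    exact c2.inter c3
  · intro x hx
    simpa using hx.2

lemma annulus_integrable {N : ℕ} {a b : ℝ} (ha : 0 < a) :
    IntegrableOn (fun x : Euc N => (‖x‖ ^ N)⁻¹) (annulus N a b) := by
  apply ContinuousOn.integrableOn_compact (annulus_compact N a b)
  apply ContinuousOn.inv₀ (by fun_prop)
  intro x hx
  have : 0 < ‖x‖ := ha.trans_le hx.1
  positivity

lemma annulus_integral {N : ℕ} (hN : 0 < N) {a b : ℝ} (ha : 0 < a) (hab : a ≤ b) :
    ∫ x in annulus N a b, (‖x‖ ^ N)⁻¹ =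
      N * (volume.real (ball (0 : Euc N) 1) * Real.log (b / a)) := by
  have hm : MeasurableSet (annulus N a b) := (annulus_compact N a b).measurableSet
  rw [← integral_indicator hm]
  have : Nontrivial (Euc N) := by
    have : Nonempty (Fin N) := ⟨⟨0, hN⟩⟩
    infer_instance
  have h1 : (annulus N a b).indicator (fun x : Euc N => (‖x‖ ^ N)⁻¹) =
      fun x => (Set.Icc a b).indicator (fun r : ℝ => (r ^ N)⁻¹) ‖x‖ := by
    ext x
    by_cases hx : x ∈ annulus N a b
    · rw [Set.indicator_of_mem hx, Set.indicator_of_mem (show ‖x‖ ∈ Set.Icc a b from hx)]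
    · rw [Set.indicator_of_notMem hx, Set.indicator_of_notMem (show ‖x‖ ∉ Set.Icc a b from hx)]
  rw [h1, integral_fun_norm_addHaar]
  have h2 : ∫ y in Set.Ioi (0 : ℝ), y ^ (Module.finrank ℝ (Euc N) - 1) •
      (Set.Icc a b).indicator (fun r : ℝ => (r ^ N)⁻¹) y = Real.log (b / a) := by
    have h3 : ∀ y ∈ Set.Ioi (0 : ℝ), y ^ (Module.finrank ℝ (Euc N) - 1) •
      (Set.Icc a b).indicator (fun r : ℝ => (r ^ N)⁻¹) y = (Set.Icc a b).indicator (fun r : ℝ => r⁻¹) y := by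
      intro y hy
      have hy' : (0 : ℝ) < y := hy
      by_cases h : y ∈ Set.Icc a b
      · rw [Set.indicator_of_mem h, Set.indicator_of_mem h, finrank_euclideanSpace_fin, smul_eq_mul]
        obtain ⟨m, rfl⟩ : ∃ m, N = m + 1 := ⟨N - 1, by omega⟩
        simp only [add_tsub_cancel_right]
        field_simp
        ring
      · rw [Set.indicator_of_notMem h, Set.indicator_of_notMem h, smul_zero]
    rw [setIntegral_congr_fun measurableSet_Ioi h3, setIntegral_indicator measurableSet_Icc]
    have h4 : Set.Ioi (0 : ℝ) ∩ Set.Icc a b = Set.Icc a b := by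
      rw [Set.inter_eq_right]
      intro y hy
      exact ha.trans_le hy.1
    rw [h4, integral_Icc_eq_integral_Ioc, ← intervalIntegral.integral_of_le hab,
      integral_inv_of_pos ha (ha.trans_le hab)]
  rw [h2]
  simp

/-! ### The integrated inequality -/

lemma energy {N : ℕ} {Ω S Cc : Set (Euc N)} (hΩ : IsOpen Ω) (hS : MeasurableSet S)
    (hCc : IsCompact Cc) (hSC : S ⊆ Cc) (hCΩ : Cc ⊆ Ω) {c p δ : ℝ} {u : Euc N → ℝ}
    (hu0 : ∀ᵐ x ∂volume, x ∈ Ω → 0 ≤ u x)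
    (huloc : LocallyIntegrableOn u (Ω) volume)
    (hup : LocallyIntegrableOn (fun x => u x ^ p) (Ω) volume)
    (hbu : LocallyIntegrableOn (fun x => c * ‖x‖ ^ (-2 : ℝ) * u x) (Ω) volume)
    {φ w g : Euc N → ℝ} (hφ : IsTestFun Ω φ) (hφ0 : ∀ x, 0 ≤ φ x)
    (hw : ContinuousOn w Cc) (hg : Integrable g) (hg0 : ∀ x, 0 ≤ g x)
    (hsuper : ∫ x in Ω, u x ^ p * φ x ≤
        ∫ x in Ω, u x * (-(lap φ x) - c * ‖x‖ ^ (-2 : ℝ) * φ x))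
    (h1 : ∀ x ∈ S, w x - δ ≤ φ x)
    (h2 : ∀ x ∈ S, 0 ≤ u x → u x * (-(lap φ x) - c * ‖x‖ ^ (-2 : ℝ) * φ x) ≤
      u x ^ p * w x / p + g x + δ * (c * ‖x‖ ^ (-2 : ℝ) * u x))
    (h3 : ∀ x ∉ S, φ x = 0 ∧ 0 ≤ lap φ x) :
    (1 - 1 / p) * ∫ x in S, u x ^ p * w x ≤
      (∫ x, g x) + δ * ((∫ x in S, u x ^ p) + ∫ x in S, c * ‖x‖ ^ (-2 : ℝ) * u x) := by
  have hSΩ : S ⊆ Ω := hSC.trans hCΩ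
  have iup : IntegrableOn (fun x => u x ^ p) S :=
    (hup.integrableOn_compact_subset hCΩ hCc).mono_set hSC
  have ibu : IntegrableOn (fun x => c * ‖x‖ ^ (-2 : ℝ) * u x) S :=
    (hbu.integrableOn_compact_subset hCΩ hCc).mono_set hSC
  have iw : IntegrableOn (fun x => u x ^ p * w x) S :=
    ((hup.integrableOn_compact_subset hCΩ hCc).mul_continuousOn hw hCc).mono_set hSC
  have iφ := integrable_u_test hup hφ
  have il := integrable_u_lap huloc hφ
  have ib := integrable_u_test hbu hφ
  have hu0' : ∀ᵐ x ∂volume.restrict Ω, 0 ≤ u x := by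
    rwa [ae_restrict_iff' hΩ.measurableSet]
  have hu0S : ∀ᵐ x ∂volume.restrict S, 0 ≤ u x := ae_restrict_of_ae_restrict_of_subset hSΩ hu0'
  have hS1 : Ω ∩ S = S := Set.inter_eq_right.2 hSΩ
  -- lower bound
  have L : (∫ x in S, u x ^ p * w x) - δ * (∫ x in S, u x ^ p) ≤ ∫ x in Ω, u x ^ p * φ x := by
    calc (∫ x in S, u x ^ p * w x) - δ * (∫ x in S, u x ^ p)
        = ∫ x in S, (u x ^ p * w x - δ * u x ^ p) := by
          rw [integral_sub iw (iup.const_mul δ), integral_const_mul]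
      _ ≤ ∫ x in S, u x ^ p * φ x := by
          apply integral_mono_ae (iw.sub (iup.const_mul δ)) iφ.integrableOn
          filter_upwards [hu0S, ae_restrict_mem hS] with x hx hxS
          have := mul_le_mul_of_nonneg_left (h1 x hxS) (Real.rpow_nonneg hx p)
          show u x ^ p * w x - δ * u x ^ p ≤ u x ^ p * φ x
          linarith
      _ ≤ ∫ x in Ω, u x ^ p * φ x := by
          apply setIntegral_mono_set iφ.integrableOn _ hSΩ.eventuallyLE
          filter_upwards [hu0'] with x hx
          exact mul_nonneg (Real.rpow_nonneg hx _) (hφ0 x)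
  have ih : IntegrableOn (fun x => u x ^ p * w x / p + g x + δ * (c * ‖x‖ ^ (-2 : ℝ) * u x)) S :=
    ((iw.div_const p).add hg.integrableOn).add (ibu.const_mul δ)
  have U : ∫ x in Ω, u x * (-(lap φ x) - c * ‖x‖ ^ (-2 : ℝ) * φ x) ≤
      ∫ x in S, (u x ^ p * w x / p + g x + δ * (c * ‖x‖ ^ (-2 : ℝ) * u x)) := by
    rw [← hS1, ← setIntegral_indicator hS]
    apply integral_mono_ae
    · have := (il.neg.sub ib).integrableOn (s := Ω)
      refine this.congr (Eventually.of_forall fun x => ?_)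
      simp only [Pi.sub_apply, Pi.neg_apply]
      ring
    · exact ((integrable_indicator_iff hS).2 ih).integrableOn
    · filter_upwards [hu0'] with x hx
      by_cases hxS : x ∈ S
      · rw [Set.indicator_of_mem hxS]
        exact h2 x hxS hx
      · rw [Set.indicator_of_notMem hxS]
        obtain ⟨h4, h5⟩ := h3 x hxS
        rw [h4]
        have := mul_nonneg hx h5
        linarith
  have E : ∫ x in S, (u x ^ p * w x / p + g x + δ * (c * ‖x‖ ^ (-2 : ℝ) * u x)) =
      (∫ x in S, u x ^ p * w x) / p + (∫ x in S, g x) + δ * ∫ x in S, c * ‖x‖ ^ (-2 : ℝ) * u x := by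
    have i1 : IntegrableOn (fun x => u x ^ p * w x / p + g x) S :=
      (iw.div_const p).add hg.integrableOn
    rw [integral_add i1 (ibu.const_mul δ),
      integral_add (iw.div_const p) hg.integrableOn, integral_const_mul, integral_div]
  have G : ∫ x in S, g x ≤ ∫ x, g x :=
    setIntegral_le_integral hg (Eventually.of_forall hg0)
  have : (1 - 1 / p) * ∫ x in S, u x ^ p * w x =
    (∫ x in S, u x ^ p * w x) - (∫ x in S, u x ^ p * w x) / p := by ring
  rw [this]
  linarith

lemma region_ball {N : ℕ} (i0 : Fin N) {K t0 t1 : ℝ} (hK : 0 < K) (ht : t0 < t1) :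
    ∃ a : Euc N, ∃ r > 0, ball a r ⊆ region i0 K t0 t1 := by
  set t := (t0 + t1) / 2 with htd
  set s := 1 / (Real.exp t + K) with hs
  have hsp : 0 < s := by positivity
  have hse : s * (Real.exp t + K) = 1 := by rw [hs]; field_simp
  set x : Euc N := EuclideanSpace.single i0 s with hx
  have hx0 : x ≠ 0 := by
    intro h
    have := congrArg (fun y : Euc N => y i0) h
    simp [hx] at this
    exact hsp.ne' this
  have hxi : x i0 = s := by simp [hx]
  have hxn : ‖x‖ = s := by rw [hx, EuclideanSpace.norm_single, Real.norm_eq_abs, abs_of_pos hsp]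
  have hSS : SS i0 K x = Real.exp t ^ 2 := by
    have h1 : 1 - 2 * K * s + K ^ 2 * s ^ 2 = s ^ 2 * Real.exp t ^ 2 := by
      have : s * Real.exp t = 1 - K * s := by linarith
      rw [← mul_pow s, this]; ring
    unfold SS
    rw [hxn, hxi, h1]
    field_simp
  have hTT : TT i0 K x = t := by
    unfold TT
    rw [hSS, Real.log_pow, Real.log_exp]
    push_cast; ring
  have hPP : 0 < PP i0 K x := by
    rw [PP_pos_iff hx0, hxi, hxn]
    have : 0 < s * Real.exp t := by positivity
    nlinarith
  have hSp : 0 < SS i0 K x := by rw [hSS]; positivity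
  have c1 := (PP_smooth i0 K hx0).continuousAt
  have c2 := (TT_smooth i0 K hx0 hSp).continuousAt
  have hev : ∀ᶠ y in 𝓝 x, y ∈ region i0 K t0 t1 := by
    filter_upwards [c1.eventually (lt_mem_nhds hPP), c2.eventually (lt_mem_nhds (show t0 < TT i0 K x by rw [hTT]; linarith)),
      c2.eventually (gt_mem_nhds (show TT i0 K x < t1 by rw [hTT]; linarith))] with y h1 h2 h3
    exact ⟨h1, h2, h3⟩
  obtain ⟨r, hr, h⟩ := Metric.mem_nhds_iff.1 hev
  exact ⟨x, r, hr, h⟩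

lemma region_measurable {N : ℕ} (i0 : Fin N) (K t0 t1 : ℝ) : MeasurableSet (region i0 K t0 t1) := by
  have hc : Measurable fun x : Euc N => x i0 := by fun_prop
  have m1 : Measurable (PP i0 K) := by
    unfold PP
    exact ((measurable_norm.pow_const 2).pow_const _).mul
      (hc.sub (measurable_const.mul (measurable_norm.pow_const 2)))
  have m2 : Measurable (TT i0 K) := by
    unfold TT SS
    exact (((measurable_norm.pow_const 2).inv.mul ((measurable_const.sub (measurable_const.mul hc)).add
      (measurable_const.mul (measurable_norm.pow_const 2)))).log).div_const 2
  exact (measurableSet_lt measurable_const m1).inter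
    ((measurableSet_lt measurable_const m2).inter (measurableSet_lt m2 measurable_const))

lemma le_of_forall_delta {a b d : ℝ} (h : ∀ δ > 0, a ≤ b + δ * d) : a ≤ b := by
  have ht : Tendsto (fun δ : ℝ => b + δ * d) (𝓝[>] 0) (𝓝 (b + 0 * d)) :=
    ((continuous_const.add (continuous_id.mul continuous_const)).tendsto 0).mono_left
      nhdsWithin_le_nhds
  rw [zero_mul, add_zero] at ht
  exact ge_of_tendsto ht (by filter_upwards [self_mem_nhdsWithin] with δ hδ using h δ hδ)

lemma main_bound {N : ℕ} (hN : 0 < N) {i0 : Fin N} {Ω : Set (Euc N)} (hΩ : IsOpen Ω)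
    {K ρ : ℝ} (hK : 0 < K)
    (hball : ∀ y : Euc N, y ≠ 0 → ‖y‖ ≤ ρ → K * ‖y‖ ^ 2 ≤ y i0 → y ∈ Ω)
    {ν c t0 : ℝ} {θ : ℕ} {M T0 : ℝ} {k : ℝ → ℝ} (hθ : θ ≤ 1) (hν : 0 ≤ ν)
    (hc : c = (N : ℝ) ^ 2 / 4 - ν ^ 2) (hc0 : 0 < c) (ht0 : 0 ≤ t0)
    (hρ : Real.exp (-t0) ≤ ρ) (hKt : K ≤ Real.exp t0) (hb : 0 ≤ (N : ℝ) / 2 - ν)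
    (hM : 0 < M) (hT0 : 1 ≤ T0) (hk : IsProfile ν (2 * K * c) t0 θ M T0 k) (n : ℕ) {ζ : ℝ → ℝ}
    {A : ℝ} (hA : 0 < A) (hsm : ContDiff ℝ (⊤ : ℕ∞) ζ) (h01 : ∀ s, 0 ≤ ζ s ∧ ζ s ≤ 1)
    (hζ2' : ∀ s, 2 ≤ s → ζ s = 0)
    (hζ1 : ∀ s, |deriv (fun s => ζ s ^ (n + 2)) s| ≤ A * ζ s ^ n)
    (hζ2 : ∀ s, |deriv (deriv (fun s => ζ s ^ (n + 2))) s| ≤ A * ζ s ^ n)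
    (hl1 : ∀ s ≤ 1, deriv (fun s => ζ s ^ (n + 2)) s = 0)
    (hl2 : ∀ s ≤ 1, deriv (deriv (fun s => ζ s ^ (n + 2))) s = 0)
    {p q : ℝ} (hpq : p.HolderConjugate q) (hq2 : 2 * q ≤ (N : ℝ) / 2 - ν + 1)
    (hn : (n + 2 : ℝ) / p ≤ n) {u : Euc N → ℝ}
    (hu0 : ∀ᵐ x ∂volume, x ∈ Ω → 0 ≤ u x)
    (huloc : LocallyIntegrableOn u (Ω) volume)
    (hup : LocallyIntegrableOn (fun x => u x ^ p) (Ω) volume)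
    (hbu : LocallyIntegrableOn (fun x => c * ‖x‖ ^ (-2 : ℝ) * u x) (Ω) volume)
    (hsuper : ∀ φ : Euc N → ℝ, IsTestFun (Ω) φ → (∀ x, 0 ≤ φ x) →
      ∫ x in Ω, u x ^ p * φ x ≤
        ∫ x in Ω, u x * (-(lap φ x) - c * ‖x‖ ^ (-2 : ℝ) * φ x))
    {T : ℝ} (hT : T0 ≤ T) :
    IntegrableOn (fun x => u x ^ p * (PP i0 K x * QQ (ν - N / 2) T n k ζ (TT i0 K x)))
      (region i0 K t0 (2 * T)) ∧
    (1 - 1 / p) * ∫ x in region i0 K t0 (2 * T),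
        u x ^ p * (PP i0 K x * QQ (ν - N / 2) T n k ζ (TT i0 K x)) ≤
      (((2 : ℝ) ^ ((N : ℝ) / 2 - ν) * (M * 2 ^ θ) * (4 * (A * (4 * M + 1))) ^ q) *
      (T ^ θ * ((T ^ (1 + θ)) ^ q)⁻¹) / q) *
        (N * (volume.real (ball (0 : Euc N) 1) *
          Real.log (Real.exp (-T) / (Real.exp (-(2 * T)) / 2)))) := by
  have hTpos : 0 < T := by linarith
  have hp := hpq.pos
  have hq := hpq.symm.pos
  obtain ⟨hks, hk0, hkpos, -, -⟩ := id hk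
  have hkn : ∀ t, 0 ≤ k t := fun t => by
    rcases le_or_gt t t0 with h | h
    · rw [hk0 t h]
    · exact (hkpos t h).le
  set Q := QQ (ν - N / 2) T n k ζ with hQdef
  have hQ : ContDiff ℝ (⊤ : ℕ∞) Q := QQ_smooth hks hsm
  have hQn : ∀ t, 0 ≤ Q t := fun t => by
    have := hkn t
    have := (h01 (t / T)).1
    rw [hQdef]; unfold QQ; positivity
  have hQ0 : ∀ t ≤ t0, Q t = 0 := fun t h => by
    rw [hQdef]; unfold QQ; rw [hk0 t h]; ring
  have hQ1 : ∀ t, 2 * T ≤ t → Q t = 0 := fun t h => by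
    rw [hQdef]; unfold QQ; rw [hζ2' _ (by rw [le_div_iff₀ hTpos]; exact h)]; simp
  set S := region i0 K t0 (2 * T) with hS
  have hSC : S ⊆ creg i0 K ρ (2 * T) := region_subset hK ht0 hρ
  have hCΩ : creg i0 K ρ (2 * T) ⊆ Ω :=
    (test_isTest hK ht0 hρ one_pos hball hQ hQn hQ0 hQ1).2
  have hwc : Continuous (fun y => PP i0 K y * Q (TT i0 K y)) :=
    (ww_smooth hK hQ (fun t ht => hQ0 t (ht.trans ht0)) hQ1).continuous
  have hCc := creg_compact i0 K ρ (2 * T)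
  refine ⟨((hup.integrableOn_compact_subset hCΩ hCc).mul_continuousOn hwc.continuousOn
    hCc).mono_set hSC, ?_⟩
  set C2 : ℝ := ((2 : ℝ) ^ ((N : ℝ) / 2 - ν) * (M * 2 ^ θ) * (4 * (A * (4 * M + 1))) ^ q) *
      (T ^ θ * ((T ^ (1 + θ)) ^ q)⁻¹) with hC2
  have hC2n : 0 ≤ C2 := by positivity
  have hea : 0 < Real.exp (-(2 * T)) / 2 := by positivity
  have heab : Real.exp (-(2 * T)) / 2 ≤ Real.exp (-T) := by
    have h1 : Real.exp (-(2 * T)) ≤ Real.exp (-T) := Real.exp_le_exp.2 (by linarith)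
    have h2 := Real.exp_pos (-(2 * T))
    linarith
  set An := annulus N (Real.exp (-(2 * T)) / 2) (Real.exp (-T)) with hAn
  have hAm : MeasurableSet An := (annulus_compact N _ _).measurableSet
  set g : Euc N → ℝ := An.indicator (fun x => C2 / q * (‖x‖ ^ N)⁻¹) with hgdef
  have hg : Integrable g := by
    rw [hgdef, integrable_indicator_iff hAm]
    exact (annulus_integrable hea).const_mul _
  have hg0 : ∀ x, 0 ≤ g x := fun x => Set.indicator_nonneg (fun y _ => by positivity) x
  have hgi : ∫ x, g x = C2 / q * (N * (volume.real (ball (0 : Euc N) 1) *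
      Real.log (Real.exp (-T) / (Real.exp (-(2 * T)) / 2)))) := by
    rw [hgdef, integral_indicator hAm, integral_const_mul, annulus_integral hN hea heab]
  rw [← hgi]
  apply le_of_forall_delta (d := (∫ x in S, u x ^ p) + ∫ x in S, c * ‖x‖ ^ (-2 : ℝ) * u x)
  intro δ hδ
  obtain ⟨hφ, -⟩ := test_isTest hK ht0 hρ hδ hball hQ hQn hQ0 hQ1
  have hφ0 : ∀ x, 0 ≤ (fun y => hh δ (PP i0 K y * Q (TT i0 K y))) x := fun x => hh_nonneg hδ _
  refine energy hΩ (region_measurable i0 K t0 (2 * T)) hCc hSC hCΩ hu0 huloc hup hbu hφ hφ0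
    hwc.continuousOn hg hg0 (hsuper _ hφ hφ0) ?_ ?_ ?_
  · intro x hx
    rcases le_or_gt (PP i0 K x * Q (TT i0 K x)) 0 with h | h
    · have := hh_nonneg hδ (PP i0 K x * Q (TT i0 K x))
      linarith
    · exact hh_ge hδ h
  · intro x hx hux
    have e1 := test_est (i0 := i0) hK hθ hν hc hc0 ht0 hM hT0 hk n hA hsm h01 hζ2' hζ1 hζ2
      hl1 hl2 hT hδ hx
    have e2 := mul_le_mul_of_nonneg_left e1 hux
    refine e2.trans ?_
    have hP : 0 < PP i0 K x := hx.1
    have hup0 : 0 ≤ u x ^ p := Real.rpow_nonneg hux p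
    have hgx := hg0 x
    by_cases hTx : T ≤ TT i0 K x
    · rw [if_pos hTx]
      obtain ⟨b1, b2, b3⟩ := power_bound hK hKt hb ht0 hM hT0 hk hA hq hq2 hT hx hTx
      have hgx' : g x = C2 / q * (‖x‖ ^ N)⁻¹ := by
        rw [hgdef, Set.indicator_of_mem (show x ∈ An from ⟨b2, b3⟩)]
      have hS1 : 0 < SS i0 K x := by
        have := (TT_pos_SS hK (by linarith [hx.2.1] : 0 < TT i0 K x)).1
        linarith
      have hy := scalar_young (u := u x)
        (a := ((‖x‖ ^ 2) ^ 2 * SS i0 K x)⁻¹ * (A * (4 * M + 1) / T ^ (1 + θ)))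
        (z := ζ (TT i0 K x / T)) hpq hux (by positivity) (h01 _).1 (h01 _).2 hn
      set a := ((‖x‖ ^ 2) ^ 2 * SS i0 K x)⁻¹ * (A * (4 * M + 1) / T ^ (1 + θ)) with ha
      set m := PP i0 K x * Real.exp ((ν - N / 2) * TT i0 K x) * k (TT i0 K x) with hm
      have hmn : 0 ≤ m := by
        have := hkn (TT i0 K x)
        positivity
      have hy2 := mul_le_mul_of_nonneg_left hy hmn
      have hwx : PP i0 K x * Q (TT i0 K x) = m * ζ (TT i0 K x / T) ^ (n + 2) := by
        rw [hQdef, hm]; unfold QQ; ring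
      have hb1 : m * a ^ q / q ≤ g x := by
        rw [hgx']
        calc m * a ^ q / q ≤ (C2 * (‖x‖ ^ N)⁻¹) / q := by gcongr
          _ = _ := by ring
      simp only [hwx]
      have e3 : u x * (m * (a * ζ (TT i0 K x / T) ^ n) + δ * (c * ‖x‖ ^ (-2 : ℝ))) =
        m * (u x * (a * ζ (TT i0 K x / T) ^ n)) + δ * (c * ‖x‖ ^ (-2 : ℝ) * u x) := by ring
      have e4 : m * (u x ^ p * ζ (TT i0 K x / T) ^ (n + 2) / p + a ^ q / q) =
        u x ^ p * (m * ζ (TT i0 K x / T) ^ (n + 2)) / p + m * a ^ q / q := by ring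
      rw [e4] at hy2
      rw [e3]
      linarith
    · rw [if_neg hTx]
      have h5 : 0 ≤ u x ^ p * (PP i0 K x * Q (TT i0 K x)) / p := by
        have := hQn (TT i0 K x)
        positivity
      have e3 : u x * (0 + δ * (c * ‖x‖ ^ (-2 : ℝ))) = δ * (c * ‖x‖ ^ (-2 : ℝ) * u x) := by ring
      rw [e3]
      linarith
  · intro x hx
    exact test_off hK ht0 hδ hQ hQn hQ0 hQ1 hx

lemma bound_tendsto {q C V : ℝ} (hq : 1 < q) (θ : ℕ) (N : ℕ) (hC : 0 ≤ C) (hV : 0 ≤ V) :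
    Tendsto (fun T : ℝ => (C * (T ^ θ * ((T ^ (1 + θ)) ^ q)⁻¹) / q) *
        (N * (V * Real.log (Real.exp (-T) / (Real.exp (-(2 * T)) / 2))))) atTop (𝓝 0) := by
  have h1 : Tendsto (fun T : ℝ => T ^ (1 + θ)) atTop atTop := tendsto_pow_atTop (by omega)
  have h2 : Tendsto (fun T : ℝ => (T ^ (1 + θ)) ^ (-(q - 1))) atTop (𝓝 0) :=
    (tendsto_rpow_neg_atTop (by linarith)).comp h1
  have h3 := h2.const_mul (C / q * (N * (V * 2)))
  rw [mul_zero] at h3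
  refine tendsto_of_tendsto_of_tendsto_of_le_of_le' tendsto_const_nhds h3 ?_ ?_
  all_goals
    filter_upwards [eventually_ge_atTop 1] with T hT
    have hTp : 0 < T := by linarith
    have hl : Real.log (Real.exp (-T) / (Real.exp (-(2 * T)) / 2)) = T + Real.log 2 := by
      have h2T : Real.exp (-T) = Real.exp (-(2 * T)) * Real.exp T := by
        rw [← Real.exp_add]; congr 1; ring
      have : Real.exp (-T) / (Real.exp (-(2 * T)) / 2) = Real.exp T * 2 := by
        rw [h2T]
        field_simp
      rw [this, Real.log_mul (Real.exp_pos T).ne' two_ne_zero, Real.log_exp]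
    have hl2 : 0 ≤ Real.log 2 := Real.log_nonneg (by norm_num)
    have hl3 : Real.log 2 ≤ 1 := by linarith [Real.log_two_lt_d9]
    rw [hl]
  · positivity
  · calc _ ≤ (C * (T ^ θ * ((T ^ (1 + θ)) ^ q)⁻¹) / q) * (N * (V * (2 * T))) := by
          gcongr; linarith
      _ = C / q * (N * (V * 2)) * (T ^ (1 + θ) * ((T ^ (1 + θ)) ^ q)⁻¹) := by
          rw [pow_add]; ring
      _ = _ := by
          congr 1
          rw [neg_sub, Real.rpow_sub (by positivity), Real.rpow_one, div_eq_mul_inv]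

/-- **Corollary 0.5.** Nonexistence of nontrivial nonnegative distributional supersolutions of
`-Δu - c|x|⁻²u ≥ uᵖ` on a smooth domain `Ω` contained in the half-space `{x¹ > 0}` with
`0 ∈ ∂Ω`, when `N - 1 < c ≤ N²/4` and `p ≥ p_{S₊^{N-1}}`. -/
theorem nonexistence_halfspace {N : ℕ} (hN : 3 ≤ N) (Ω : Set (Euc N))
    (hΩ : IsSmoothDomain Ω)
    (hΩhalf : Ω ⊆ {x : Euc N | 0 < x ⟨0, by omega⟩})
    (h0 : (0 : Euc N) ∈ frontier Ω)
    (c p : ℝ) (hc1 : (N : ℝ) - 1 < c) (hc2 : c ≤ (N : ℝ) ^ 2 / 4)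
    (hp : 1 + 2 / (((N : ℝ) - 2) / 2 - Real.sqrt ((N : ℝ) ^ 2 / 4 - c)) ≤ p)
    (u : Euc N → ℝ)
    (hu0 : ∀ᵐ x ∂volume, x ∈ Ω → 0 ≤ u x)
    (huloc : LocallyIntegrableOn u (Ω) volume)
    (hup : LocallyIntegrableOn (fun x => u x ^ p) (Ω) volume)
    (hbu : LocallyIntegrableOn (fun x => c * ‖x‖ ^ (-2 : ℝ) * u x) (Ω) volume)
    (hsuper : ∀ φ : Euc N → ℝ, IsTestFun (Ω) φ → (∀ x, 0 ≤ φ x) →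
      ∫ x in Ω, u x ^ p * φ x ≤
        ∫ x in Ω, u x * (-(lap φ x) - c * ‖x‖ ^ (-2 : ℝ) * φ x)) :
    ∀ᵐ x ∂volume, x ∈ Ω → u x = 0 := by
  set i0 : Fin N := ⟨0, by omega⟩ with hi0
  set ν := Real.sqrt ((N : ℝ) ^ 2 / 4 - c) with hνd
  have hN3 : (3 : ℝ) ≤ N := by exact_mod_cast hN
  have hν : 0 ≤ ν := Real.sqrt_nonneg _
  have hν2 : ν ^ 2 = (N : ℝ) ^ 2 / 4 - c := Real.sq_sqrt (by linarith)
  have hc : c = (N : ℝ) ^ 2 / 4 - ν ^ 2 := by linarith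
  have hc0 : 0 < c := by linarith
  set α := ((N : ℝ) - 2) / 2 - ν with hα
  have hαp : 0 < α := by
    have : ν < ((N : ℝ) - 2) / 2 := by
      apply lt_of_pow_lt_pow_left₀ 2 (by linarith)
      rw [hν2]; nlinarith
    rw [hα]; linarith
  have h2α : 0 < 2 / α := by positivity
  have hp1 : 1 < p := by linarith
  set q := p.conjExponent with hqd
  have hpq : p.HolderConjugate q := Real.HolderConjugate.conjExponent hp1
  have hp' : 0 < p := hpq.pos
  have hpm : 0 < p - 1 := by linarith
  have hq2 : 2 * q ≤ (N : ℝ) / 2 - ν + 1 := by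
    have h1 : q = 1 + 1 / (p - 1) := by
      rw [hqd, Real.conjExponent]; field_simp; ring
    have h2 : 2 ≤ α * (p - 1) := by
      have : 2 / α ≤ p - 1 := by linarith
      rw [div_le_iff₀ hαp] at this
      linarith
    have h3 : 2 * (1 / (p - 1)) ≤ α := by
      rw [mul_one_div, div_le_iff₀ hpm]; exact h2
    rw [h1]
    linarith
  obtain ⟨n, hn'⟩ := exists_nat_ge (2 / (p - 1))
  have hn : (n + 2 : ℝ) / p ≤ n := by
    rw [div_le_iff₀ hpm] at hn'
    rw [div_le_iff₀ hp']
    linarith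
  obtain ⟨K, hK, ρ, hρ, hball⟩ := interior_ball i0 hΩ (fun x hx => hΩhalf hx) h0
  obtain ⟨t0, θ, M, T0, k, htm, hθ, hM, hT0, htT, hk⟩ := exists_profile (C := 2 * K * c) hν
    (by positivity) (max 0 (max (Real.log K) (-Real.log ρ)))
  have ht0 : 0 ≤ t0 := (le_max_left _ _).trans htm
  have hKt : K ≤ Real.exp t0 := by
    rw [← Real.log_le_iff_le_exp hK]
    exact (le_max_left _ _).trans ((le_max_right _ _).trans htm)
  have hρt : Real.exp (-t0) ≤ ρ := by
    rw [← Real.le_log_iff_exp_le hρ]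
    have := (le_max_right _ _).trans ((le_max_right _ _).trans htm)
    linarith
  obtain ⟨ζ, A, hA, hsm, hζ1', hζ2', h01, hζ1, hζ2, hl1, hl2⟩ := exists_cutoff n
  have hb : 0 ≤ (N : ℝ) / 2 - ν := by rw [hα] at hαp; linarith
  have hΩo := hΩ.1
  have key := fun (T : ℝ) (hT : T0 ≤ T) => main_bound (by omega) (i0 := i0) hΩo hK hball hθ hν hc hc0
    ht0 hρt hKt hb hM hT0 hk n hA hsm h01 hζ2' hζ1 hζ2 hl1 hl2 hpq hq2 hn hu0 huloc hup hbu
    hsuper hT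
  obtain ⟨hks, hk0, hkpos, -, -⟩ := id hk
  have hCΩ : creg i0 K ρ T0 ⊆ Ω := fun y hy => hball y (creg_ne_zero hK hy) hy.2.2 hy.1
  have hRΩ : region i0 K t0 T0 ⊆ Ω := (region_subset hK ht0 hρt).trans hCΩ
  have hRm := region_measurable i0 K t0 T0
  have hu0' : ∀ᵐ x ∂volume.restrict Ω, 0 ≤ u x := by
    rwa [ae_restrict_iff' hΩo.measurableSet]
  set w : Euc N → ℝ := fun x => PP i0 K x * (Real.exp ((ν - N / 2) * TT i0 K x) * k (TT i0 K x))
    with hw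
  have hQw : ∀ T, T0 ≤ T → ∀ x ∈ region i0 K t0 T0,
      PP i0 K x * QQ (ν - N / 2) T n k ζ (TT i0 K x) = w x := by
    intro T hT x hx
    have : ζ (TT i0 K x / T) = 1 := hζ1' _ (by
      rw [div_le_one (by linarith)]; exact hx.2.2.le.trans hT)
    rw [hw]; unfold QQ; simp only; rw [this]; ring
  have hwpos : ∀ x ∈ region i0 K t0 T0, 0 < w x := fun x hx => by
    have := hkpos _ hx.2.1
    have := hx.1
    rw [hw]; positivity
  have hsub : ∀ T, T0 ≤ T → region i0 K t0 T0 ⊆ region i0 K t0 (2 * T) := fun T hT x hx =>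
    ⟨hx.1, hx.2.1, hx.2.2.trans_le (by linarith)⟩
  have hintg : IntegrableOn (fun x => u x ^ p * w x) (region i0 K t0 T0) := by
    refine ((key T0 le_rfl).1.mono_set (hsub T0 le_rfl)).congr_fun (fun x hx => ?_) hRm
    simp only [hQw T0 le_rfl x hx]
  have hle : ∀ T, T0 ≤ T → ∫ x in region i0 K t0 T0, u x ^ p * w x ≤
      ∫ x in region i0 K t0 (2 * T),
        u x ^ p * (PP i0 K x * QQ (ν - N / 2) T n k ζ (TT i0 K x)) := by
    intro T hT
    have : ∫ x in region i0 K t0 T0, u x ^ p * w x = ∫ x in region i0 K t0 T0,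
        u x ^ p * (PP i0 K x * QQ (ν - N / 2) T n k ζ (TT i0 K x)) :=
      setIntegral_congr_fun hRm (fun x hx => by simp only [hQw T hT x hx])
    rw [this]
    apply setIntegral_mono_set (key T hT).1 _ (hsub T hT).eventuallyLE
    have hRΩ2 : region i0 K t0 (2 * T) ⊆ Ω := fun y hy => by
      have hy' := region_subset hK ht0 hρt hy
      exact hball y (creg_ne_zero hK hy') hy'.2.2 hy'.1
    filter_upwards [ae_restrict_of_ae_restrict_of_subset hRΩ2 hu0',
      ae_restrict_mem (region_measurable i0 K t0 (2 * T))] with x hx hxS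
    have h1 := hkpos _ hxS.2.1
    have h2 := hxS.1
    have h3 := (h01 (TT i0 K x / T)).1
    have h4 := Real.rpow_nonneg hx p
    show 0 ≤ u x ^ p * (PP i0 K x * QQ (ν - N / 2) T n k ζ (TT i0 K x))
    unfold QQ
    positivity
  have hp2 : 0 < 1 - 1 / p := by
    rw [sub_pos, div_lt_one hp']; exact hp1
  have hlim := bound_tendsto (C := ((2 : ℝ) ^ ((N : ℝ) / 2 - ν) * (M * 2 ^ θ) *
    (4 * (A * (4 * M + 1))) ^ q)) (V := volume.real (ball (0 : Euc N) 1)) hpq.symm.lt θ N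
    (by positivity) measureReal_nonneg
  have hI0 : (1 - 1 / p) * ∫ x in region i0 K t0 T0, u x ^ p * w x ≤ 0 := by
    apply ge_of_tendsto hlim
    filter_upwards [eventually_ge_atTop T0] with T hT
    exact (mul_le_mul_of_nonneg_left (hle T hT) hp2.le).trans (key T hT).2
  have hI1 : ∫ x in region i0 K t0 T0, u x ^ p * w x ≤ 0 := by
    by_contra h
    exact absurd hI0 (not_le.2 (mul_pos hp2 (not_le.1 h)))
  have huR : ∀ᵐ x ∂volume.restrict (region i0 K t0 T0), 0 ≤ u x :=
    ae_restrict_of_ae_restrict_of_subset hRΩ hu0'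
  have hnn : 0 ≤ᵐ[volume.restrict (region i0 K t0 T0)] fun x => u x ^ p * w x := by
    filter_upwards [huR, ae_restrict_mem hRm] with x hx hxS
    exact mul_nonneg (Real.rpow_nonneg hx p) (hwpos x hxS).le
  have hI : ∫ x in region i0 K t0 T0, u x ^ p * w x = 0 :=
    le_antisymm hI1 (integral_nonneg_of_ae hnn)
  have hz := (setIntegral_eq_zero_iff_of_nonneg_ae hnn hintg).1 hI
  have hzu : ∀ᵐ x ∂volume, x ∈ region i0 K t0 T0 → u x = 0 := by
    rw [← ae_restrict_iff' hRm]
    filter_upwards [hz, huR, ae_restrict_mem hRm] with x hx hx0 hxS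
    have h1 : u x ^ p * w x = 0 := hx
    rcases mul_eq_zero.1 h1 with h | h
    · exact (Real.rpow_eq_zero hx0 hp'.ne').1 h
    · exact absurd h (hwpos x hxS).ne'
  obtain ⟨a, r, hr, har⟩ := region_ball i0 hK htT
  refine zero_everywhere i0 hΩo hΩ.2.2.1.isPreconnected ?_ hc0 hu0 huloc hbu hsuper a hr
    (hRΩ (har (mem_ball_self hr))) ?_
  · intro h
    have : (0 : ℝ) < (0 : Euc N) i0 := hΩhalf h
    simp at this
  · filter_upwards [hzu] with x hx hxb
    exact hx (har hxb)
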